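/- Under the standing assumptions, the diagonal contribution of the two-point function is negligible: for all f₁, f₂ ∈ C_c^∞(𝔹), the limit lim_{a→0} ∬_{𝔹², |z₁−z₂|>a} f₁(z₁) f₂(z₂) k₂(z₁, z₂) dz₁ dz₂ exists and equals K₂(f₁, f₂) = E[(h^𝔹, f₁)(h^𝔹, f₂)]. -/

import Mathlib

open MeasureTheory ProbabilityTheory Metric Filter Topology Set

noncomputable section

abbrev Euc (d : ℕ) : Type := EuclideanSpace ℝ (Fin d)

/-- The scaling function `s`: `s(r) = -log r` if `d = 2`, and `s(r) = r^(2-d)` if `d ≥ 3`. -/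
noncomputable def sFun (d : ℕ) (r : ℝ) : ℝ :=
  if d = 2 then -Real.log r else r ^ ((2 : ℝ) - (d : ℝ))

open Classical in
/-- The zero boundary Green's function of the open unit ball in `ℝ^d`:
`G(x,y) = s(|x-y|) - s(|x|·|y - x/|x|²|)`, interpreted by continuity at `x = 0`. -/
noncomputable def greenBall (d : ℕ) (x y : Euc d) : ℝ :=
  if x = 0 then sFun d ‖y‖ - sFun d 1
  else sFun d ‖x - y‖ - sFun d (‖x‖ * ‖y - (‖x‖ ^ 2)⁻¹ • x‖)

/-- Smooth compactly supported test functions. -/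
def IsTestFun {d : ℕ} (f : Euc d → ℝ) : Prop :=
  ContDiff ℝ (⊤ : ℕ∞) f ∧ HasCompactSupport f

/-- The Laplacian of `u : ℝ^d → ℝ` at `x`, as the sum of pure second derivatives in the
coordinate directions. -/
noncomputable def lap {d : ℕ} (u : Euc d → ℝ) (x : Euc d) : ℝ :=
  ∑ i : Fin d, iteratedFDeriv ℝ 2 u x ![EuclideanSpace.single i 1, EuclideanSpace.single i 1]

/-- A function is harmonic on a set if it is twice continuously differentiable there with
vanishing Laplacian. -/
def IsHarmonicOn {d : ℕ} (u : Euc d → ℝ) (s : Set (Euc d)) : Prop :=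
  ContDiffOn ℝ 2 u s ∧ ∀ x ∈ s, lap u x = 0

/-- A real random variable is a (possibly degenerate) centered Gaussian. -/
def IsCenteredGaussianRV {Ω : Type} [MeasurableSpace Ω] (P : Measure Ω) (Y : Ω → ℝ) : Prop :=
  ∃ v : NNReal, Measure.map Y P = ProbabilityTheory.gaussianReal 0 v

/-- The standing assumptions: a collection of stochastic processes `h a r` (thought of as
`h^{a + r𝔹}`) indexed by test functions, which is centered, a.s. linear, zero outside the ball,
translation/scaling covariant, satisfies the domain Markov property (with the decomposition
recorded as data `H`, `Φ`, `φharm`), has fourth moments, a (sequentially) continuous covariance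
bilinear form on `C_c^∞(𝔹)`, and zero boundary conditions. -/
structure GFF (d : ℕ) (Ω : Type) [MeasurableSpace Ω] where
  P : Measure Ω
  prob : IsProbabilityMeasure P
  /-- the field `h^{a+r𝔹}` tested against `f` -/
  h : Euc d → ℝ → (Euc d → ℝ) → Ω → ℝ
  meas_h : ∀ a r f, Measurable (h a r f)
  integrable_h : ∀ a r f, IsTestFun f → Integrable (h a r f) P
  /-- centered -/
  centered : ∀ a r f, IsTestFun f → ∫ ω, h a r f ω ∂P = 0
  /-- (1) a.s. linearity in the test function -/
  lin_add : ∀ f g : Euc d → ℝ, IsTestFun f → IsTestFun g →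
    ∀ᵐ ω ∂P, h 0 1 (f + g) ω = h 0 1 f ω + h 0 1 g ω
  lin_smul : ∀ (c : ℝ) (f : Euc d → ℝ), IsTestFun f →
    ∀ᵐ ω ∂P, h 0 1 (c • f) ω = c * h 0 1 f ω
  /-- (2) the field vanishes on test functions supported outside the ball -/
  zero_outside : ∀ f : Euc d → ℝ, IsTestFun f → tsupport f ⊆ (ball (0 : Euc d) 1)ᶜ →
    ∀ᵐ ω ∂P, h 0 1 f ω = 0
  /-- (3) translation and scaling: `(h^{a+r𝔹}, f((·-a)/r)) = r^{1+d/2} (h^𝔹, f)` in law,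
  as processes (equality of finite dimensional distributions) -/
  scaling : ∀ (a : Euc d) (r : ℝ), 0 < r → ∀ (k : ℕ) (f : Fin k → Euc d → ℝ),
    (∀ i, IsTestFun (f i)) →
    Measure.map (fun ω (i : Fin k) => h a r (fun x => f i (r⁻¹ • (x - a))) ω) P
      = Measure.map (fun ω (i : Fin k) => r ^ (1 + (d : ℝ) / 2) * h 0 1 (f i) ω) P
  /-- (4) domain Markov property: the decomposition data. `H a r` is the independent copy of
  `h^{a+r𝔹}`, `Φ a r` is the harmonic part as a process, `φharm a r ω` is the harmonic function. -/
  H : Euc d → ℝ → (Euc d → ℝ) → Ω → ℝ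
  Φ : Euc d → ℝ → (Euc d → ℝ) → Ω → ℝ
  φharm : Euc d → ℝ → Ω → Euc d → ℝ
  meas_H : ∀ a r f, Measurable (H a r f)
  meas_Φ : ∀ a r f, Measurable (Φ a r f)
  meas_φharm : ∀ a r z, Measurable fun ω => φharm a r ω z
  dmp_decomp : ∀ (a : Euc d) (r : ℝ), 0 < r → ball a r ⊆ ball (0 : Euc d) 1 →
    ∀ f : Euc d → ℝ, IsTestFun f → ∀ᵐ ω ∂P, h 0 1 f ω = H a r f ω + Φ a r f ω
  dmp_indep : ∀ (a : Euc d) (r : ℝ), 0 < r → ball a r ⊆ ball (0 : Euc d) 1 →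
    ProbabilityTheory.Indep
      (⨆ f : {f : Euc d → ℝ // IsTestFun f}, MeasurableSpace.comap (H a r f.1) inferInstance)
      ((⨆ f : {f : Euc d → ℝ // IsTestFun f}, MeasurableSpace.comap (Φ a r f.1) inferInstance) ⊔
        (⨆ z : Euc d, MeasurableSpace.comap (fun ω => φharm a r ω z) inferInstance)) P
  dmp_law : ∀ (a : Euc d) (r : ℝ), 0 < r → ball a r ⊆ ball (0 : Euc d) 1 →
    ∀ (k : ℕ) (f : Fin k → Euc d → ℝ), (∀ i, IsTestFun (f i)) →
    Measure.map (fun ω (i : Fin k) => H a r (f i) ω) P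
      = Measure.map (fun ω (i : Fin k) => h a r (f i) ω) P
  dmp_harm : ∀ (a : Euc d) (r : ℝ), 0 < r → ball a r ⊆ ball (0 : Euc d) 1 →
    ∀ᵐ ω ∂P, IsHarmonicOn (φharm a r ω) (ball a r) ∧
      ∀ f : Euc d → ℝ, IsTestFun f → tsupport f ⊆ ball a r →
        Φ a r f ω = ∫ x in ball a r, φharm a r ω x * f x
  /-- (5) fourth moments -/
  mom4 : ∀ f : Euc d → ℝ, IsTestFun f → Integrable (fun ω => (h 0 1 f ω) ^ 4) P
  /-- (6) sequential continuity of the covariance bilinear form on `C_c^∞(𝔹)` -/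
  K2_cont : ∀ (f : ℕ → Euc d → ℝ) (f₀ g : Euc d → ℝ) (K : Set (Euc d)),
    IsCompact K → K ⊆ ball (0 : Euc d) 1 →
    (∀ n, IsTestFun (f n)) → IsTestFun f₀ → IsTestFun g → tsupport g ⊆ ball (0 : Euc d) 1 →
    (∀ n, tsupport (f n) ⊆ K) → tsupport f₀ ⊆ K →
    (∀ m : ℕ, TendstoUniformly (fun n => iteratedFDeriv ℝ m (f n)) (iteratedFDeriv ℝ m f₀) atTop) →
    Tendsto (fun n => ∫ ω, h 0 1 (f n) ω * h 0 1 g ω ∂P) atTop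
      (𝓝 (∫ ω, h 0 1 f₀ ω * h 0 1 g ω ∂P))
  /-- (7) zero boundary conditions -/
  zero_bdry : ∀ f : ℕ → Euc d → ℝ,
    (∀ n, IsTestFun (f n)) → (∀ n x, 0 ≤ f n x) →
    (∃ C : ℝ, ∀ n, ∫ x, f n x ≤ C) →
    Tendsto (fun n => Metric.infDist (0 : Euc d) (tsupport (f n))) atTop (𝓝 1) →
    (∃ C : ℝ, ∀ (n : ℕ) (x y : Euc d), ‖x‖ = ‖y‖ → ‖x‖ < 1 → f n x ≤ C * f n y) →
    Tendsto (fun n => ∫ ω, (h 0 1 (f n) ω) ^ 2 ∂P) atTop (𝓝 0)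

instance {d : ℕ} {Ω : Type} [MeasurableSpace Ω] (X : GFF d Ω) : IsProbabilityMeasure X.P :=
  X.prob

/-- A valid choice of radius in the definition of the two-point function. -/
noncomputable def k2eps {d : ℕ} (z₁ z₂ : Euc d) : ℝ :=
  min (dist z₁ z₂ / 2) (min (1 - ‖z₁‖) (1 - ‖z₂‖)) / 2

/-- The two-point function `k₂(z₁,z₂) = E[φ^{z₁+ε𝔹}_𝔹(z₁) φ^{z₂+ε𝔹}_𝔹(z₂)]`
(independent of the admissible choice of `ε`, under the standing assumptions). -/
noncomputable def GFF.k2 {d : ℕ} {Ω : Type} [MeasurableSpace Ω] (X : GFF d Ω) (z₁ z₂ : Euc d) : ℝ :=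
  ∫ ω, X.φharm z₁ (k2eps z₁ z₂) ω z₁ * X.φharm z₂ (k2eps z₁ z₂) ω z₂ ∂X.P

lemma hasFDerivAt_radial {d : ℕ} {g p : ℝ → ℝ} (hp : ∀ t, HasDerivAt p (g t) t) (x : Euc d) :
    HasFDerivAt (fun y : Euc d => p (‖y‖ ^ 2) / 2) (g (‖x‖ ^ 2) • innerSL ℝ x) x := by
  have h1 : HasFDerivAt (fun y : Euc d => ‖y‖ ^ 2) (2 • innerSL ℝ x) x :=
    (hasStrictFDerivAt_norm_sq x).hasFDerivAt
  have h2 := (((hp (‖x‖ ^ 2)).comp_hasFDerivAt x h1).mul_const (1 / 2 : ℝ))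
  have h3 : ((1 / 2 : ℝ) • g (‖x‖ ^ 2) • (2 • innerSL ℝ x)) = g (‖x‖ ^ 2) • innerSL ℝ x := by
    ext w
    simp
    ring
  rw [h3] at h2
  refine h2.congr_of_eventuallyEq (Eventually.of_forall fun y => ?_)
  simp [div_eq_mul_inv]

/-- A primitive of `g` vanishing on `[b, ∞)` when `g` does. -/
lemma exists_primitive_eq_zero {g : ℝ → ℝ} (hg : Continuous g) {b : ℝ}
    (hb : ∀ t, b ≤ t → g t = 0) :
    ∃ p : ℝ → ℝ, (∀ t, HasDerivAt p (g t) t) ∧ ∀ t, b ≤ t → p t = 0 := by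
  refine ⟨fun t => ∫ y in b..t, g y, fun t => ?_, fun t ht => ?_⟩
  · exact intervalIntegral.integral_hasDerivAt_right (hg.intervalIntegrable _ _)
      (hg.stronglyMeasurableAtFilter _ _) hg.continuousAt
  · change ∫ y in b..t, g y = 0
    rw [intervalIntegral.integral_congr (g := fun _ => (0 : ℝ))]
    · simp
    · intro y hy
      rw [uIcc_of_le ht] at hy
      exact hb y hy.1

lemma sq_le_norm_sq_of_notMem_closedBall {d : ℕ} {s : ℝ} (hs : 0 < s) {x : Euc d}
    (hx : x ∉ closedBall (0 : Euc d) s) : s ^ 2 ≤ ‖x‖ ^ 2 := by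
  rw [mem_closedBall_zero_iff, not_le] at hx
  gcongr

lemma hasCompactSupport_radial {d : ℕ} {g : ℝ → ℝ} {s : ℝ} (hs : 0 < s)
    (hg0 : ∀ t, s ^ 2 ≤ t → g t = 0) : HasCompactSupport (fun x : Euc d => g (‖x‖ ^ 2)) :=
  HasCompactSupport.intro (isCompact_closedBall (0 : Euc d) s)
    fun _ hx => hg0 _ (sq_le_norm_sq_of_notMem_closedBall hs hx)

lemma fderiv_euc_apply_eq_sum {d : ℕ} (L : Euc d →L[ℝ] ℝ) (x : Euc d) :
    L x = ∑ i, x i * L (EuclideanSpace.single i 1) := by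
  conv_lhs => rw [← (EuclideanSpace.basisFun (Fin d) ℝ).sum_repr x]
  simp

/-- The derivative of dilated radial averages of a harmonic function vanishes. -/
lemma integral_fderiv_mul_radial_eq_zero {d : ℕ} {v : Euc d → ℝ} {a : Euc d} {s s' : ℝ}
    (hv : ContDiff ℝ 2 v) (hs : 0 < s) (hss : s < s') (hlap : ∀ x ∈ ball a s', lap v x = 0)
    {g : ℝ → ℝ} (hg : ContDiff ℝ (⊤ : ℕ∞) g) (hg0 : ∀ t, s ^ 2 ≤ t → g t = 0)
    {t : ℝ} (ht : t ∈ Icc (0 : ℝ) 1) :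
    ∫ x, fderiv ℝ v (a + t • x) x * g (‖x‖ ^ 2) = 0 := by
  obtain ⟨p, hp, hp0⟩ := exists_primitive_eq_zero hg.continuous hg0
  set q : Euc d → ℝ := fun y => p (‖y‖ ^ 2) / 2 with hq
  have hqd : ∀ x : Euc d, HasFDerivAt q (g (‖x‖ ^ 2) • innerSL ℝ x) x := hasFDerivAt_radial hp
  have hqc : Continuous q := continuous_iff_continuousAt.2 fun x => (hqd x).continuousAt
  have hgc : Continuous fun x : Euc d => g (‖x‖ ^ 2) := hg.continuous.comp (by fun_prop)
  have hq0 : ∀ x, x ∉ closedBall (0 : Euc d) s → q x = 0 := fun x hx => by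
    simp [hq, hp0 _ (sq_le_norm_sq_of_notMem_closedBall hs hx)]
  have hqs : HasCompactSupport q := HasCompactSupport.intro (isCompact_closedBall (0 : Euc d) s) hq0
  have hgs : HasCompactSupport (fun x : Euc d => g (‖x‖ ^ 2)) := hasCompactSupport_radial hs hg0
  have hv1 : ContDiff ℝ 1 (fderiv ℝ v) := hv.fderiv_right (by norm_num)
  have hv2 : Continuous (fderiv ℝ (fderiv ℝ v)) := hv1.continuous_fderiv one_ne_zero
  have hc1 : Continuous fun x : Euc d => fderiv ℝ v (a + t • x) :=
    hv1.continuous.comp (by fun_prop)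
  have hc2 : Continuous fun x : Euc d => fderiv ℝ (fderiv ℝ v) (a + t • x) :=
    hv2.comp (by fun_prop)
  have key : ∀ i : Fin d, ∫ x, fderiv ℝ v (a + t • x) (EuclideanSpace.single i 1) *
      (g (‖x‖ ^ 2) * x i) = - ∫ x, (t * fderiv ℝ (fderiv ℝ v) (a + t • x)
        (EuclideanSpace.single i 1) (EuclideanSpace.single i 1)) * q x := by
    intro i
    refine integral_bilinear_hasLineDerivAt_right_eq_neg_left_of_integrable
      (B := ContinuousLinearMap.mul ℝ ℝ) (v := EuclideanSpace.single i 1) ?_ ?_ ?_ ?_ ?_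
    · refine Continuous.integrable_of_hasCompactSupport ?_ ?_
      · simp only [ContinuousLinearMap.mul_apply']
        fun_prop
      · exact hqs.mul_left
    · refine Continuous.integrable_of_hasCompactSupport ?_ ?_
      · simp only [ContinuousLinearMap.mul_apply']
        fun_prop
      · exact (hgs.mul_right).mul_left
    · refine Continuous.integrable_of_hasCompactSupport ?_ ?_
      · simp only [ContinuousLinearMap.mul_apply']
        fun_prop
      · exact hqs.mul_left
    · intro x _
      have h1 : HasFDerivAt (fun x : Euc d => a + t • x) (t • ContinuousLinearMap.id ℝ (Euc d)) x :=
        ((hasFDerivAt_id x).const_smul t).const_add a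
      have h2 := ((hv1.differentiable one_ne_zero) (a + t • x)).hasFDerivAt.comp x h1
      have h3 := (h2.clm_apply (hasFDerivAt_const (EuclideanSpace.single i (1 : ℝ)) x)).hasLineDerivAt
        (EuclideanSpace.single i 1)
      convert! h3 using 1
      simp
    · intro x _
      have := (hqd x).hasLineDerivAt (EuclideanSpace.single i 1)
      convert! this using 1
      simp [EuclideanSpace.inner_single_right]
  have h1 : ∀ x : Euc d, fderiv ℝ v (a + t • x) x * g (‖x‖ ^ 2)
      = ∑ i, fderiv ℝ v (a + t • x) (EuclideanSpace.single i 1) * (g (‖x‖ ^ 2) * x i) := by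
    intro x
    rw [fderiv_euc_apply_eq_sum (fderiv ℝ v (a + t • x)) x, Finset.sum_mul]
    exact Finset.sum_congr rfl fun i _ => by ring
  simp_rw [h1]
  rw [integral_finsetSum _ fun i _ => ?_]
  · simp_rw [key]
    rw [Finset.sum_neg_distrib, ← integral_finsetSum _ fun i _ => ?_]
    · rw [neg_eq_zero]
      refine integral_eq_zero_of_ae (Eventually.of_forall fun x => ?_)
      by_cases hx : x ∈ closedBall (0 : Euc d) s
      · have hm : a + t • x ∈ ball a s' := by
          rw [mem_ball_iff_norm, add_sub_cancel_left, norm_smul, Real.norm_of_nonneg ht.1]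
          rw [mem_closedBall_zero_iff] at hx
          calc t * ‖x‖ ≤ 1 * s := by
                exact mul_le_mul ht.2 hx (norm_nonneg x) zero_le_one
            _ < s' := by linarith
        have := hlap _ hm
        simp only [lap, iteratedFDeriv_two_apply] at this
        simp only [Matrix.cons_val_zero, Matrix.cons_val_one] at this
        simp only [Pi.zero_apply, ← Finset.sum_mul, ← Finset.mul_sum, this]
        simp
      · simp [hq0 x hx]
    · refine Continuous.integrable_of_hasCompactSupport ?_ hqs.mul_left
      fun_prop
  · refine Continuous.integrable_of_hasCompactSupport ?_ (hgs.mul_right).mul_left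
    fun_prop

lemma integral_mul_radial_of_contDiff {d : ℕ} {v : Euc d → ℝ} {a : Euc d} {s s' : ℝ}
    (hv : ContDiff ℝ 2 v) (hs : 0 < s) (hss : s < s') (hlap : ∀ x ∈ ball a s', lap v x = 0)
    {g : ℝ → ℝ} (hg : ContDiff ℝ (⊤ : ℕ∞) g) (hg0 : ∀ t, s ^ 2 ≤ t → g t = 0) :
    ∫ x, v x * g (‖x - a‖ ^ 2) = v a * ∫ x : Euc d, g (‖x‖ ^ 2) := by
  have hgc : Continuous fun x : Euc d => g (‖x‖ ^ 2) := hg.continuous.comp (by fun_prop)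
  have hgs : HasCompactSupport (fun x : Euc d => g (‖x‖ ^ 2)) := hasCompactSupport_radial hs hg0
  have hv1 : Continuous (fderiv ℝ v) := hv.continuous_fderiv two_ne_zero
  have hvc := hv.continuous
  set I : ℝ → ℝ := fun t => ∫ x, v (a + t • x) * g (‖x‖ ^ 2) with hI
  have hF' : Continuous fun z : ℝ × Euc d => fderiv ℝ v (a + z.1 • z.2) z.2 * g (‖z.2‖ ^ 2) := by
    have h1 : Continuous fun z : ℝ × Euc d => fderiv ℝ v (a + z.1 • z.2) := hv1.comp (by fun_prop)
    have h2 : Continuous fun z : ℝ × Euc d => g (‖z.2‖ ^ 2) := hg.continuous.comp (by fun_prop)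
    fun_prop
  have hder : ∀ t : ℝ, HasDerivAt I (∫ x, fderiv ℝ v (a + t • x) x * g (‖x‖ ^ 2)) t := by
    intro t
    obtain ⟨C, hC⟩ := ((isCompact_closedBall t 1).prod
      (isCompact_closedBall (0 : Euc d) s)).exists_bound_of_continuousOn hF'.continuousOn
    refine (hasDerivAt_integral_of_dominated_loc_of_deriv_le (μ := volume)
      (F := fun t x => v (a + t • x) * g (‖x‖ ^ 2))
      (F' := fun t x => fderiv ℝ v (a + t • x) x * g (‖x‖ ^ 2))
      (bound := (closedBall (0 : Euc d) s).indicator fun _ => C) (closedBall_mem_nhds t one_pos)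
      ?_ ?_ ?_ ?_ ?_ ?_).2
    · refine Eventually.of_forall fun t => Continuous.aestronglyMeasurable ?_
      fun_prop
    · refine Continuous.integrable_of_hasCompactSupport ?_ hgs.mul_left
      fun_prop
    · exact Continuous.aestronglyMeasurable (hF'.comp (by fun_prop : Continuous fun x => (t, x)))
    · refine Eventually.of_forall fun x t' ht' => ?_
      by_cases hx : x ∈ closedBall (0 : Euc d) s
      · rw [indicator_of_mem hx]
        exact hC (t', x) ⟨ht', hx⟩
      · rw [indicator_of_notMem hx, hg0 _ (sq_le_norm_sq_of_notMem_closedBall hs hx)]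
        simp
    · refine IntegrableOn.integrable_indicator ?_ measurableSet_closedBall
      exact integrableOn_const (measure_closedBall_lt_top).ne
    · refine Eventually.of_forall fun x t' _ => ?_
      have h1 : HasDerivAt (fun t : ℝ => a + t • x) x t' := by
        simpa using ((hasDerivAt_id t').smul_const x).const_add a
      exact (((hv.differentiable two_ne_zero) (a + t' • x)).hasFDerivAt.comp_hasDerivAt t' h1).mul_const _
  have hconst := constant_of_has_deriv_right_zero (f := I) (a := 0) (b := 1)
    (fun t _ => (hder t).continuousAt.continuousWithinAt)
    (fun t ht => by
      have := (hder t).hasDerivWithinAt (s := Ici t)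
      rwa [integral_fderiv_mul_radial_eq_zero hv hs hss hlap hg hg0 ⟨ht.1, ht.2.le⟩] at this) 1
    ⟨zero_le_one, le_rfl⟩
  have h0 : I 0 = v a * ∫ x : Euc d, g (‖x‖ ^ 2) := by
    simp [hI, integral_const_mul]
  rw [← h0, ← hconst, hI]
  simp only [one_smul]
  rw [← integral_add_left_eq_self (fun x => v x * g (‖x - a‖ ^ 2)) a]
  simp

/-- Mean value property of harmonic functions against radial weights. -/
lemma IsHarmonicOn.integral_mul_radial {d : ℕ} {u : Euc d → ℝ} {a : Euc d} {s r : ℝ}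
    (hu : IsHarmonicOn u (ball a r)) (hs : 0 < s) (hsr : s < r)
    {g : ℝ → ℝ} (hg : ContDiff ℝ (⊤ : ℕ∞) g) (hg0 : ∀ t, s ^ 2 ≤ t → g t = 0) :
    ∫ x in ball a r, u x * g (‖x - a‖ ^ 2) = u a * ∫ x : Euc d, g (‖x‖ ^ 2) := by
  obtain ⟨s', hs'1, hs'2⟩ := exists_between hsr
  obtain ⟨t, ht1, ht2⟩ := exists_between hs'2
  let χ : ContDiffBump a := ⟨s', t, hs.trans hs'1, ht1⟩
  set v : Euc d → ℝ := fun x => χ x * u x with hvdef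
  have hveq : ∀ x ∈ closedBall a s', v x = u x := fun x hx => by
    simp [hvdef, χ.one_of_mem_closedBall hx]
  have hv : ContDiff ℝ 2 v := by
    rw [contDiff_iff_contDiffAt]
    intro x
    by_cases hx : x ∈ ball a r
    · exact (χ.contDiff.contDiffAt).mul (hu.1.contDiffAt (isOpen_ball.mem_nhds hx))
    · have hx' : x ∉ tsupport χ := by
        rw [χ.tsupport_eq]
        exact fun h => hx (closedBall_subset_ball ht2 h)
      have : v =ᶠ[𝓝 x] fun _ => 0 := by
        filter_upwards [(isClosed_tsupport χ).isOpen_compl.mem_nhds hx'] with y hy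
        simp [hvdef, image_eq_zero_of_notMem_tsupport hy]
      exact contDiffAt_const.congr_of_eventuallyEq this
  have hlap : ∀ x ∈ ball a s', lap v x = 0 := fun x hx => by
    have hev : v =ᶠ[𝓝 x] u := by
      filter_upwards [isOpen_ball.mem_nhds hx] with y hy using hveq y (ball_subset_closedBall hy)
    rw [← hu.2 x (ball_subset_ball hs'2.le hx)]
    simp only [lap, (hev.iteratedFDeriv ℝ 2).eq_of_nhds]
  have h := integral_mul_radial_of_contDiff hv hs hs'1 hlap hg hg0
  rw [hveq a (mem_closedBall_self (hs.trans hs'1).le)] at h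
  have hz : ∀ x, x ∉ closedBall a s → g (‖x - a‖ ^ 2) = 0 := fun x hx =>
    hg0 _ (sq_le_norm_sq_of_notMem_closedBall hs (by simpa [dist_eq_norm] using hx))
  rw [← h, setIntegral_eq_integral_of_forall_compl_eq_zero]
  · congr 1 with x
    by_cases hx : x ∈ closedBall a s
    · rw [hveq x (closedBall_subset_closedBall hs'1.le hx)]
    · simp [hz x hx]
  · intro x hx
    rw [hz x fun h' => hx (closedBall_subset_ball hsr h'), mul_zero]

/-- `g` is the profile of a smooth radial function `x ↦ g (‖x‖ ^ 2)` on `ℝ^d`, supported in the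
closed ball of radius `s` and of total integral one. -/
structure IsProfile (d : ℕ) (g : ℝ → ℝ) (s : ℝ) : Prop where
  pos : 0 < s
  contDiff : ContDiff ℝ (⊤ : ℕ∞) g
  eq_zero : ∀ t, s ^ 2 ≤ t → g t = 0
  integral_eq_one : ∫ x : Euc d, g (‖x‖ ^ 2) = 1

/-- The radial function with profile `g` centred at `a`. -/
def radial {d : ℕ} (g : ℝ → ℝ) (a : Euc d) : Euc d → ℝ := fun x => g (‖x - a‖ ^ 2)

lemma IsProfile.radial_eq_zero {d : ℕ} {g : ℝ → ℝ} {s : ℝ} (hg : IsProfile d g s) {a x : Euc d}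
    (hx : x ∉ closedBall a s) : radial g a x = 0 :=
  hg.eq_zero _ (sq_le_norm_sq_of_notMem_closedBall hg.pos (by simpa [dist_eq_norm] using hx))

lemma IsProfile.tsupport_radial_subset {d : ℕ} {g : ℝ → ℝ} {s : ℝ} (hg : IsProfile d g s)
    (a : Euc d) : tsupport (radial g a) ⊆ closedBall a s :=
  closure_minimal (fun _ hx => by_contra fun h => hx (hg.radial_eq_zero h)) isClosed_closedBall

lemma IsProfile.contDiff_radial {d : ℕ} {g : ℝ → ℝ} {s : ℝ} (hg : IsProfile d g s) (a : Euc d) :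
    ContDiff ℝ (⊤ : ℕ∞) (radial g a) :=
  hg.contDiff.comp ((contDiff_norm_sq ℝ).comp (contDiff_id.sub contDiff_const))

lemma IsProfile.isTestFun_radial {d : ℕ} {g : ℝ → ℝ} {s : ℝ} (hg : IsProfile d g s) (a : Euc d) :
    IsTestFun (radial g a) :=
  ⟨hg.contDiff_radial a, HasCompactSupport.intro (isCompact_closedBall a s)
    fun _ hx => hg.radial_eq_zero hx⟩

lemma integral_radial {d : ℕ} (g : ℝ → ℝ) (a : Euc d) :
    ∫ x, radial g a x = ∫ x : Euc d, g (‖x‖ ^ 2) :=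
  integral_sub_right_eq_self (fun x : Euc d => g (‖x‖ ^ 2)) a

/-- The profile of the dilation by `ε` of the radial function with profile `g`. -/
def dilateProfile (d : ℕ) (g : ℝ → ℝ) (ε : ℝ) : ℝ → ℝ := fun t => (ε ^ d)⁻¹ * g (t / ε ^ 2)

lemma radial_dilateProfile {d : ℕ} (g : ℝ → ℝ) {ε : ℝ} (hε : 0 < ε) (a x : Euc d) :
    radial (dilateProfile d g ε) a x = (ε ^ d)⁻¹ * radial g 0 (ε⁻¹ • (x - a)) := by
  simp only [radial, dilateProfile, sub_zero, norm_smul, norm_inv, Real.norm_of_nonneg hε.le,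
    mul_pow, div_eq_inv_mul, inv_pow]

lemma IsProfile.dilate {d : ℕ} {g : ℝ → ℝ} {s : ℝ} (hg : IsProfile d g s) {ε : ℝ} (hε : 0 < ε) :
    IsProfile d (dilateProfile d g ε) (ε * s) where
  pos := mul_pos hε hg.pos
  contDiff := contDiff_const.mul (hg.contDiff.comp (contDiff_id.div_const _))
  eq_zero t ht := by
    have : s ^ 2 ≤ t / ε ^ 2 := by
      rw [le_div_iff₀ (by positivity)]
      calc s ^ 2 * ε ^ 2 = (ε * s) ^ 2 := by ring
        _ ≤ t := ht
    simp [dilateProfile, hg.eq_zero _ this]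
  integral_eq_one := by
    have h1 : ∀ x : Euc d, dilateProfile d g ε (‖x‖ ^ 2)
        = (ε ^ d)⁻¹ * (fun y : Euc d => g (‖y‖ ^ 2)) (ε⁻¹ • x) := fun x => by
      simpa [radial] using radial_dilateProfile g hε (0 : Euc d) x
    simp_rw [h1]
    have h2 := Measure.integral_comp_inv_smul (volume : Measure (Euc d))
      (fun y : Euc d => g (‖y‖ ^ 2)) ε
    rw [integral_const_mul, h2, hg.integral_eq_one]
    have : 0 < ε ^ d := by positivity
    simp only [finrank_euclideanSpace, Fintype.card_fin, abs_of_pos this, smul_eq_mul, mul_one]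
    exact inv_mul_cancel₀ (ne_of_gt this)

/-- There are nonnegative profiles supported in any given annulus. -/
lemma exists_isProfile {d : ℕ} (hd : 1 ≤ d) {s₁ s₂ : ℝ} (h₁ : 0 < s₁) (h₂ : s₁ < s₂) :
    ∃ g : ℝ → ℝ, IsProfile d g s₂ ∧ (∀ t, 0 ≤ g t) ∧ ∀ t, t ≤ s₁ ^ 2 → g t = 0 := by
  have hs : s₁ ^ 2 < s₂ ^ 2 := by gcongr
  set c := (s₁ ^ 2 + s₂ ^ 2) / 2 with hc
  set ρ := (s₂ ^ 2 - s₁ ^ 2) / 2 with hρ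
  have hρ0 : 0 < ρ := by rw [hρ]; linarith
  let b : ContDiffBump c := ⟨ρ / 2, ρ, by linarith, by linarith⟩
  have hb0 : ∀ t, ρ ≤ |t - c| → b t = 0 := fun t ht => by
    refine b.zero_of_le_dist ?_
    rw [Real.dist_eq]
    exact ht
  have hb2 : ∀ t, s₂ ^ 2 ≤ t → b t = 0 := fun t ht =>
    hb0 t (le_trans (by rw [hρ, hc]; linarith) (le_abs_self _))
  have hb1 : ∀ t, t ≤ s₁ ^ 2 → b t = 0 := fun t ht =>
    hb0 t (le_trans (by rw [hρ, hc]; linarith) (neg_le_abs _))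
  have hcont : Continuous fun x : Euc d => b (‖x‖ ^ 2) := b.continuous.comp (by fun_prop)
  have hpos : 0 < ∫ x : Euc d, b (‖x‖ ^ 2) := by
    refine hcont.integral_pos_of_hasCompactSupport_nonneg_nonzero
      (hasCompactSupport_radial (h₁.trans h₂) hb2) (fun x => b.nonneg)
      (x := EuclideanSpace.single (⟨0, hd⟩ : Fin d) (√c)) ?_
    have hc0 : 0 ≤ c := by rw [hc]; positivity
    have : ‖EuclideanSpace.single (⟨0, hd⟩ : Fin d) (√c)‖ ^ 2 = c := by
      rw [PiLp.norm_single, Real.norm_of_nonneg (Real.sqrt_nonneg _), Real.sq_sqrt hc0]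
    simp only [this]
    rw [b.one_of_mem_closedBall (mem_closedBall_self (by positivity))]
    exact one_ne_zero
  refine ⟨fun t => (∫ x : Euc d, b (‖x‖ ^ 2))⁻¹ * b t, ⟨h₁.trans h₂, contDiff_const.mul b.contDiff,
    fun t ht => by simp [hb2 t ht], ?_⟩, fun t => mul_nonneg (inv_nonneg.2 hpos.le) b.nonneg,
    fun t ht => by simp [hb1 t ht]⟩
  rw [integral_const_mul, inv_mul_cancel₀ hpos.ne']

lemma tsupport_radial_subset_annulus {d : ℕ} {g : ℝ → ℝ} {s₁ s₂ : ℝ} (hg : IsProfile d g s₂)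
    (h : ∀ t, t ≤ s₁ ^ 2 → g t = 0) :
    tsupport (radial g (0 : Euc d)) ⊆ {x | s₁ ≤ ‖x‖ ∧ ‖x‖ ≤ s₂} := by
  refine closure_minimal (fun x hx => ⟨?_, ?_⟩)
    ((isClosed_le continuous_const continuous_norm).inter
      (isClosed_le continuous_norm continuous_const))
  · by_contra! hlt
    exact hx (h _ (by simpa using pow_le_pow_left₀ (norm_nonneg x) hlt.le 2))
  · by_contra! hlt
    exact hx (hg.radial_eq_zero (by simpa using hlt))

lemma IsTestFun.add {d : ℕ} {f g : Euc d → ℝ} (hf : IsTestFun f) (hg : IsTestFun g) :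
    IsTestFun (f + g) :=
  ⟨hf.1.add hg.1, hf.2.add hg.2⟩

lemma IsTestFun.const_smul {d : ℕ} {f : Euc d → ℝ} (hf : IsTestFun f) (c : ℝ) :
    IsTestFun (c • f) :=
  ⟨contDiff_const.smul hf.1, hf.2.smul_left (f := fun _ => c)⟩

lemma IsTestFun.comp_dilate {d : ℕ} {f : Euc d → ℝ} (hf : IsTestFun f) (a : Euc d) {r : ℝ}
    (hr : r ≠ 0) : IsTestFun fun y => f (a + r • y) := by
  refine ⟨hf.1.comp (contDiff_const.add (contDiff_id.const_smul r)), ?_⟩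
  exact hf.2.comp_homeomorph ((Homeomorph.smulOfNeZero r hr).trans (Homeomorph.addLeft a))

namespace GFF

variable {d : ℕ} {Ω : Type} [MeasurableSpace Ω] (X : GFF d Ω)

lemma memLp_h {f : Euc d → ℝ} (hf : IsTestFun f) : MemLp (X.h 0 1 f) 2 X.P := by
  rw [memLp_two_iff_integrable_sq (X.meas_h 0 1 f).aestronglyMeasurable]
  refine ((integrable_const (1 : ℝ)).add (X.mom4 f hf)).mono'
    ((X.meas_h 0 1 f).pow_const 2).aestronglyMeasurable (Eventually.of_forall fun ω => ?_)
  rw [Real.norm_of_nonneg (sq_nonneg _)]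
  simp only [Pi.add_apply]
  nlinarith [sq_nonneg (X.h 0 1 f ω ^ 2 - 1), sq_nonneg (X.h 0 1 f ω ^ 2)]

/-- The law of the field in the ball `a + r𝔹` produced by the domain Markov property. -/
lemma identDistrib_H {a : Euc d} {r : ℝ} (hr : 0 < r) (hB : ball a r ⊆ ball (0 : Euc d) 1)
    {f : Euc d → ℝ} (hf : IsTestFun f) :
    IdentDistrib (X.H a r f)
      (fun ω => r ^ (1 + (d : ℝ) / 2) * X.h 0 1 (fun y => f (a + r • y)) ω) X.P X.P := by
  refine ⟨(X.meas_H a r f).aemeasurable, ((X.meas_h 0 1 _).const_mul _).aemeasurable, ?_⟩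
  have hft := hf.comp_dilate a hr.ne'
  have h1 := X.dmp_law a r hr hB 1 (fun _ => f) fun _ => hf
  have h2 := X.scaling a r hr 1 (fun _ y => f (a + r • y)) fun _ => hft
  have h3 : (fun x => f (a + r • r⁻¹ • (x - a))) = f := by
    ext x
    rw [smul_inv_smul₀ hr.ne']
    simp
  simp only [h3] at h2
  have h4 := congrArg (Measure.map fun v : Fin 1 → ℝ => v 0) (h1.trans h2)
  rwa [Measure.map_map (measurable_pi_apply 0) (measurable_pi_lambda _ fun _ => X.meas_H a r f),
    Measure.map_map (measurable_pi_apply 0)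
      (measurable_pi_lambda _ fun _ => (X.meas_h 0 1 _).const_mul _)] at h4

section Markov

variable {a : Euc d} {r : ℝ}

lemma memLp_H (hr : 0 < r) (hB : ball a r ⊆ ball (0 : Euc d) 1)
    {f : Euc d → ℝ} (hf : IsTestFun f) : MemLp (X.H a r f) 2 X.P :=
  (X.identDistrib_H hr hB hf).symm.memLp_snd
    ((X.memLp_h (hf.comp_dilate a hr.ne')).const_mul _)

lemma integral_H (hr : 0 < r) (hB : ball a r ⊆ ball (0 : Euc d) 1)
    {f : Euc d → ℝ} (hf : IsTestFun f) : ∫ ω, X.H a r f ω ∂X.P = 0 := by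
  rw [(X.identDistrib_H hr hB hf).integral_eq, integral_const_mul,
    X.centered _ _ _ (hf.comp_dilate a hr.ne'), mul_zero]

lemma integral_H_sq (hr : 0 < r) (hB : ball a r ⊆ ball (0 : Euc d) 1)
    {f : Euc d → ℝ} (hf : IsTestFun f) : ∫ ω, X.H a r f ω ^ 2 ∂X.P
    = r ^ (2 + d) * ∫ ω, X.h 0 1 (fun y => f (a + r • y)) ω ^ 2 ∂X.P := by
  have h := ((X.identDistrib_H hr hB hf).comp (measurable_id.pow_const 2)).integral_eq
  simp only [Function.comp_def, id] at h
  rw [h]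
  simp_rw [mul_pow]
  rw [integral_const_mul, ← Real.rpow_natCast (r ^ _), ← Real.rpow_mul hr.le,
    ← Real.rpow_natCast r]
  congr 2
  push_cast
  ring

lemma H_ae_eq_zero (hr : 0 < r) (hB : ball a r ⊆ ball (0 : Euc d) 1)
    {f : Euc d → ℝ} (hf : IsTestFun f) (hs : tsupport f ⊆ (ball a r)ᶜ) :
    X.H a r f =ᵐ[X.P] 0 := by
  have hz := X.zero_outside _ (hf.comp_dilate a hr.ne') (by
    refine (tsupport_comp_subset_preimage f (by fun_prop)).trans fun y hy hy1 => hs hy ?_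
    rw [mem_ball_zero_iff] at hy1
    rw [mem_ball_iff_norm, add_sub_cancel_left, norm_smul, Real.norm_of_nonneg hr.le]
    nlinarith)
  have h0 : ∫ ω, X.H a r f ω ^ 2 ∂X.P = 0 := by
    rw [X.integral_H_sq hr hB hf, integral_eq_zero_of_ae, mul_zero]
    filter_upwards [hz] with ω hω
    simp [hω]
  have h1 := (integral_eq_zero_iff_of_nonneg (fun ω => sq_nonneg (X.H a r f ω))
    (X.memLp_H hr hB hf).integrable_sq).1 h0
  filter_upwards [h1] with ω hω
  simpa using hω

lemma memLp_Phi (hr : 0 < r) (hB : ball a r ⊆ ball (0 : Euc d) 1)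
    {f : Euc d → ℝ} (hf : IsTestFun f) : MemLp (X.Φ a r f) 2 X.P := by
  refine ((X.memLp_h hf).sub (X.memLp_H hr hB hf)).ae_eq ?_
  filter_upwards [X.dmp_decomp a r hr hB f hf] with ω hω
  simp [hω]

lemma indepFun_H_Phi (hr : 0 < r) (hB : ball a r ⊆ ball (0 : Euc d) 1)
    {f g : Euc d → ℝ} (hf : IsTestFun f) (hg : IsTestFun g) :
    IndepFun (X.H a r f) (X.Φ a r g) X.P := by
  rw [IndepFun_iff_Indep]
  refine indep_of_indep_of_le_left (indep_of_indep_of_le_right (X.dmp_indep a r hr hB) ?_) ?_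
  · exact le_sup_of_le_left (le_iSup (fun f : {f : Euc d → ℝ // IsTestFun f} =>
      MeasurableSpace.comap (X.Φ a r f.1) inferInstance) ⟨g, hg⟩)
  · exact le_iSup (fun f : {f : Euc d → ℝ // IsTestFun f} =>
      MeasurableSpace.comap (X.H a r f.1) inferInstance) ⟨f, hf⟩

lemma integral_H_mul_Phi (hr : 0 < r) (hB : ball a r ⊆ ball (0 : Euc d) 1)
    {f g : Euc d → ℝ} (hf : IsTestFun f) (hg : IsTestFun g) :
    ∫ ω, X.H a r f ω * X.Φ a r g ω ∂X.P = 0 := by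
  rw [(X.indepFun_H_Phi hr hB hf hg).integral_fun_mul_eq_mul_integral
    (X.memLp_H hr hB hf).1 (X.memLp_Phi hr hB hg).1, X.integral_H hr hB hf, zero_mul]

lemma integral_h_sq (hr : 0 < r) (hB : ball a r ⊆ ball (0 : Euc d) 1)
    {f : Euc d → ℝ} (hf : IsTestFun f) : ∫ ω, X.h 0 1 f ω ^ 2 ∂X.P
    = ∫ ω, X.H a r f ω ^ 2 ∂X.P + ∫ ω, X.Φ a r f ω ^ 2 ∂X.P := by
  have hH := X.memLp_H hr hB hf
  have hΦ := X.memLp_Phi hr hB hf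
  have h1 : ∫ ω, X.h 0 1 f ω ^ 2 ∂X.P = ∫ ω, (X.H a r f ω ^ 2 + X.Φ a r f ω ^ 2)
      + 2 * (X.H a r f ω * X.Φ a r f ω) ∂X.P := by
    refine integral_congr_ae ?_
    filter_upwards [X.dmp_decomp a r hr hB f hf] with ω hω
    rw [hω]
    ring
  have h2 : Integrable (fun ω => X.H a r f ω * X.Φ a r f ω) X.P := hH.integrable_mul hΦ
  rw [h1, integral_add (f := fun ω => X.H a r f ω ^ 2 + X.Φ a r f ω ^ 2)
    (hH.integrable_sq.add hΦ.integrable_sq) (h2.const_mul 2), integral_const_mul, X.integral_H_mul_Phi hr hB hf hf,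
    integral_add hH.integrable_sq hΦ.integrable_sq]
  ring

/-- The harmonic part tested against a radial function is its value at the centre. -/
lemma Phi_radial_ae_eq (hr : 0 < r) (hB : ball a r ⊆ ball (0 : Euc d) 1)
    {g : ℝ → ℝ} {s : ℝ} (hg : IsProfile d g s) (hs : s < r) :
    X.Φ a r (radial g a) =ᵐ[X.P] fun ω => X.φharm a r ω a := by
  filter_upwards [X.dmp_harm a r hr hB] with ω hω
  rw [hω.2 _ (hg.isTestFun_radial a)
    ((hg.tsupport_radial_subset a).trans (closedBall_subset_ball hs))]
  exact (hω.1.integral_mul_radial hg.pos hs hg.contDiff hg.eq_zero).trans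
    (by rw [hg.integral_eq_one, mul_one])

/-- The covariance of the field tested against a radial function in a ball and the field tested
against a function supported outside of that ball. -/
lemma integral_h_radial_mul_h (hr : 0 < r) (hB : ball a r ⊆ ball (0 : Euc d) 1)
    {g : ℝ → ℝ} {s : ℝ} (hg : IsProfile d g s) (hs : s < r)
    {f : Euc d → ℝ} (hf : IsTestFun f) (hfs : tsupport f ⊆ (ball a r)ᶜ) :
    ∫ ω, X.h 0 1 (radial g a) ω * X.h 0 1 f ω ∂X.P
      = ∫ ω, X.φharm a r ω a * X.h 0 1 f ω ∂X.P := by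
  have hψ := hg.isTestFun_radial a
  have h1 : ∀ᵐ ω ∂X.P, X.h 0 1 f ω = X.Φ a r f ω := by
    filter_upwards [X.dmp_decomp a r hr hB f hf, X.H_ae_eq_zero hr hB hf hfs] with ω h1 h2
    rw [h1, h2, Pi.zero_apply, zero_add]
  have h2 : ∫ ω, X.h 0 1 (radial g a) ω * X.h 0 1 f ω ∂X.P
      = ∫ ω, X.H a r (radial g a) ω * X.Φ a r f ω
        + X.Φ a r (radial g a) ω * X.Φ a r f ω ∂X.P := by
    refine integral_congr_ae ?_
    filter_upwards [X.dmp_decomp a r hr hB _ hψ, h1] with ω h1 h2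
    rw [h1, h2, add_mul]
  have h3 : Integrable (fun ω => X.H a r (radial g a) ω * X.Φ a r f ω) X.P :=
    (X.memLp_H hr hB hψ).integrable_mul (X.memLp_Phi hr hB hf)
  have h4 : Integrable (fun ω => X.Φ a r (radial g a) ω * X.Φ a r f ω) X.P :=
    (X.memLp_Phi hr hB hψ).integrable_mul (X.memLp_Phi hr hB hf)
  rw [h2, integral_add h3 h4,
    X.integral_H_mul_Phi hr hB hψ hf, zero_add]
  refine integral_congr_ae ?_
  filter_upwards [h1, X.Phi_radial_ae_eq hr hB hg hs] with ω h1 h2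
  rw [h1, h2]

/-- The value at the centre of the harmonic part is a limit in `L²` of the field tested against
radial functions concentrating near the boundary of the ball. -/
lemma exists_radial_tendsto_harm (hr : 0 < r) (hB : ball a r ⊆ ball (0 : Euc d) 1)
    (hd : 1 ≤ d) : ∃ (g : ℕ → ℝ → ℝ) (s : ℕ → ℝ),
    (∀ n, IsProfile d (g n) (s n)) ∧ (∀ n, s n < r) ∧
    Tendsto (fun n => ∫ ω, (X.h 0 1 (radial (g n) a) ω - X.φharm a r ω a) ^ 2 ∂X.P) atTop
      (𝓝 0) := by
  set t : ℕ → ℝ := fun n => 1 - 1 / ((n : ℝ) + 2) with ht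
  have ht0 : ∀ n, 0 < t n := fun n => by
    have h2 : (0 : ℝ) < (n : ℝ) + 2 := by positivity
    have : 1 / ((n : ℝ) + 2) < 1 := by
      rw [div_lt_one h2]
      have : (0 : ℝ) ≤ n := Nat.cast_nonneg n
      linarith
    simp only [ht]
    linarith
  have ht1 : ∀ n, t n < 1 := fun n => by
    have : 0 < 1 / ((n : ℝ) + 2) := by positivity
    simp only [ht]
    linarith
  have htlim : Tendsto t atTop (𝓝 1) := by
    have h1 : Tendsto (fun n : ℕ => 1 / ((n : ℝ) + 2)) atTop (𝓝 0) := by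
      refine tendsto_const_nhds.div_atTop ?_
      exact tendsto_atTop_add_const_right _ _ tendsto_natCast_atTop_atTop
    simpa [ht] using h1.const_sub 1
  choose g hg hgnn hg0 using fun n => exists_isProfile (d := d) hd (ht0 n)
    (show t n < (t n + 1) / 2 by linarith [ht1 n])
  have hlim : Tendsto (fun n => ∫ ω, X.h 0 1 (radial (g n) 0) ω ^ 2 ∂X.P) atTop (𝓝 0) := by
    refine X.zero_bdry (fun n => radial (g n) 0) (fun n => (hg n).isTestFun_radial 0)
      (fun n x => hgnn n _) ⟨1, fun n => ?_⟩ ?_ ⟨1, fun n x y hxy _ => ?_⟩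
    · rw [integral_radial, (hg n).integral_eq_one]
    · have hsub := fun n => tsupport_radial_subset_annulus (hg n) (hg0 n)
      have hne : ∀ n, (tsupport (radial (g n) (0 : Euc d))).Nonempty := fun n => by
        by_contra h
        rw [not_nonempty_iff_eq_empty, tsupport_eq_empty_iff] at h
        have h1 := (hg n).integral_eq_one
        rw [← integral_radial _ (0 : Euc d), h] at h1
        simp at h1
      refine tendsto_of_tendsto_of_tendsto_of_le_of_le htlim tendsto_const_nhds
        (fun n => ?_) (fun n => ?_)
      · refine (le_infDist (hne n)).2 fun y hy => ?_
        rw [dist_zero_left]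
        exact (hsub n hy).1
      · obtain ⟨y, hy⟩ := hne n
        refine (infDist_le_dist_of_mem hy).trans ?_
        rw [dist_zero_left]
        exact (hsub n hy).2.trans (by linarith [ht1 n])
    · simp [radial, hxy]
  refine ⟨fun n => dilateProfile d (g n) r, fun n => r * ((t n + 1) / 2),
    fun n => (hg n).dilate hr, fun n => ?_, ?_⟩
  · nlinarith [ht1 n]
  · have hkey : ∀ n, ∫ ω, (X.h 0 1 (radial (dilateProfile d (g n) r) a) ω
        - X.φharm a r ω a) ^ 2 ∂X.P
        = r ^ (2 + d) * ((r ^ d)⁻¹ ^ 2 * ∫ ω, X.h 0 1 (radial (g n) 0) ω ^ 2 ∂X.P) := by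
      intro n
      have hp := (hg n).dilate hr
      have htest := hp.isTestFun_radial a
      have h1 : ∫ ω, (X.h 0 1 (radial (dilateProfile d (g n) r) a) ω
          - X.φharm a r ω a) ^ 2 ∂X.P
          = ∫ ω, X.H a r (radial (dilateProfile d (g n) r) a) ω ^ 2 ∂X.P := by
        refine integral_congr_ae ?_
        filter_upwards [X.dmp_decomp a r hr hB _ htest,
          X.Phi_radial_ae_eq hr hB hp (by nlinarith [ht1 n])] with ω h1 h2
        rw [h1, h2, add_sub_cancel_right]
      rw [h1, X.integral_H_sq hr hB htest]
      congr 1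
      have h2 : (fun y : Euc d => radial (dilateProfile d (g n) r) a (a + r • y))
          = (r ^ d)⁻¹ • radial (g n) 0 := by
        ext y
        rw [radial_dilateProfile _ hr, add_sub_cancel_left, inv_smul_smul₀ hr.ne']
        rfl
      rw [h2, ← integral_const_mul]
      refine integral_congr_ae ?_
      filter_upwards [X.lin_smul (r ^ d)⁻¹ _ ((hg n).isTestFun_radial 0)] with ω hω
      rw [hω, mul_pow]
    simp_rw [hkey]
    have h := (hlim.const_mul ((r ^ d)⁻¹ ^ 2)).const_mul (r ^ (2 + d))
    rwa [mul_zero, mul_zero] at h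

end Markov

end GFF

lemma IsTestFun.sub {d : ℕ} {f g : Euc d → ℝ} (hf : IsTestFun f) (hg : IsTestFun g) :
    IsTestFun (f - g) :=
  ⟨hf.1.sub hg.1, hf.2.sub hg.2⟩

namespace GFF

variable {d : ℕ} {Ω : Type} [MeasurableSpace Ω] (X : GFF d Ω)

open Classical in
/-- The field in the unit ball, as a map from test functions to `L²`. -/
def toL2 (f : Euc d → ℝ) : Lp ℝ 2 X.P :=
  if hf : IsTestFun f then (X.memLp_h hf).toLp else 0

lemma toL2_ae_eq {f : Euc d → ℝ} (hf : IsTestFun f) : X.toL2 f =ᵐ[X.P] X.h 0 1 f := by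
  rw [toL2, dif_pos hf]
  exact MemLp.coeFn_toLp _

lemma toL2_add {f g : Euc d → ℝ} (hf : IsTestFun f) (hg : IsTestFun g) :
    X.toL2 (f + g) = X.toL2 f + X.toL2 g := by
  refine Lp.ext ?_
  filter_upwards [X.toL2_ae_eq hf, X.toL2_ae_eq hg, X.toL2_ae_eq (hf.add hg),
    Lp.coeFn_add (X.toL2 f) (X.toL2 g), X.lin_add f g hf hg] with ω h1 h2 h3 h4 h5
  rw [h3, h4, h5, Pi.add_apply, h1, h2]

lemma toL2_smul {f : Euc d → ℝ} (hf : IsTestFun f) (c : ℝ) :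
    X.toL2 (c • f) = c • X.toL2 f := by
  refine Lp.ext ?_
  filter_upwards [X.toL2_ae_eq hf, X.toL2_ae_eq (hf.const_smul c),
    Lp.coeFn_smul c (X.toL2 f), X.lin_smul c f hf] with ω h1 h2 h3 h4
  rw [h2, h3, h4, Pi.smul_apply, h1, smul_eq_mul]

lemma toL2_sub {f g : Euc d → ℝ} (hf : IsTestFun f) (hg : IsTestFun g) :
    X.toL2 (f - g) = X.toL2 f - X.toL2 g := by
  have h := X.toL2_add (hf.sub hg) hg
  rw [sub_add_cancel] at h
  rw [h, add_sub_cancel_right]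

lemma inner_toL2 {f g : Euc d → ℝ} (hf : IsTestFun f) (hg : IsTestFun g) :
    inner ℝ (X.toL2 f) (X.toL2 g) = ∫ ω, X.h 0 1 f ω * X.h 0 1 g ω ∂X.P := by
  rw [L2.inner_def]
  refine integral_congr_ae ?_
  filter_upwards [X.toL2_ae_eq hf, X.toL2_ae_eq hg] with ω h1 h2
  rw [h1, h2]
  simp [mul_comm]

lemma norm_toL2_sq {f : Euc d → ℝ} (hf : IsTestFun f) :
    ‖X.toL2 f‖ ^ 2 = ∫ ω, X.h 0 1 f ω ^ 2 ∂X.P := by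
  rw [← real_inner_self_eq_norm_sq, X.inner_toL2 hf hf]
  simp_rw [sq]

/-- The value at the centre of the harmonic part, as an element of `L²`. -/
lemma exists_harmL2 (hd : 1 ≤ d) {a : Euc d} {r : ℝ} (hr : 0 < r)
    (hB : ball a r ⊆ ball (0 : Euc d) 1) : ∃ ϕ : Lp ℝ 2 X.P,
      (ϕ =ᵐ[X.P] fun ω => X.φharm a r ω a) ∧
      (∀ (g : ℝ → ℝ) (s : ℝ), IsProfile d g s → s < r → ∀ f : Euc d → ℝ, IsTestFun f →
        tsupport f ⊆ (ball a r)ᶜ →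
          inner ℝ (X.toL2 (radial g a)) (X.toL2 f) = inner ℝ ϕ (X.toL2 f)) ∧
      ∃ (g : ℕ → ℝ → ℝ) (s : ℕ → ℝ), (∀ n, IsProfile d (g n) (s n)) ∧ (∀ n, s n < r) ∧
        Tendsto (fun n => X.toL2 (radial (g n) a)) atTop (𝓝 ϕ) := by
  obtain ⟨g, s, hg, hs, hlim⟩ := X.exists_radial_tendsto_harm hr hB hd
  have hmem : MemLp (fun ω => X.φharm a r ω a) 2 X.P :=
    (X.memLp_Phi hr hB ((hg 0).isTestFun_radial a)).ae_eq
      (X.Phi_radial_ae_eq hr hB (hg 0) (hs 0))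
  have hϕ : hmem.toLp =ᵐ[X.P] fun ω => X.φharm a r ω a := MemLp.coeFn_toLp hmem
  refine ⟨hmem.toLp, hϕ, fun g s hg hs f hf hfs => ?_, g, s, hg, hs, ?_⟩
  · rw [X.inner_toL2 (hg.isTestFun_radial a) hf, X.integral_h_radial_mul_h hr hB hg hs hf hfs,
      L2.inner_def]
    refine integral_congr_ae ?_
    filter_upwards [hϕ, X.toL2_ae_eq hf] with ω h1 h2
    rw [h1, h2]
    simp [mul_comm]
  · rw [tendsto_iff_norm_sub_tendsto_zero]
    have h1 : ∀ n, ‖X.toL2 (radial (g n) a) - hmem.toLp‖ ^ 2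
        = ∫ ω, (X.h 0 1 (radial (g n) a) ω - X.φharm a r ω a) ^ 2 ∂X.P := by
      intro n
      rw [← real_inner_self_eq_norm_sq, L2.inner_def]
      refine integral_congr_ae ?_
      filter_upwards [hϕ, X.toL2_ae_eq ((hg n).isTestFun_radial a),
        Lp.coeFn_sub (X.toL2 (radial (g n) a)) hmem.toLp] with ω h1 h2 h3
      rw [h3, Pi.sub_apply, h1, h2]
      simp [sq]
    simp_rw [← h1] at hlim
    simpa [Real.sqrt_sq] using hlim.sqrt

/-- The two-point function is the covariance of the field tested against small radial functions. -/
lemma inner_toL2_radial_eq_k2 (hd : 1 ≤ d) {z w : Euc d} (hzw : z ≠ w)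
    {g g' : ℝ → ℝ} {s s' : ℝ} (hg : IsProfile d g s) (hg' : IsProfile d g' s')
    (hs : s < k2eps z w) (hs' : s' < k2eps z w) :
    inner ℝ (X.toL2 (radial g z)) (X.toL2 (radial g' w)) = X.k2 z w := by
  set r := k2eps z w with hrdef
  have hr : 0 < r := hg.pos.trans hs
  have hdist : 0 < dist z w := dist_pos.2 hzw
  have hr1 : 2 * r ≤ dist z w / 2 := by
    have : min (dist z w / 2) (min (1 - ‖z‖) (1 - ‖w‖)) ≤ dist z w / 2 := min_le_left _ _
    rw [hrdef, k2eps]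
    linarith
  have hr2 : 2 * r ≤ 1 - ‖z‖ := by
    have : min (dist z w / 2) (min (1 - ‖z‖) (1 - ‖w‖)) ≤ 1 - ‖z‖ :=
      (min_le_right _ _).trans (min_le_left _ _)
    rw [hrdef, k2eps]
    linarith
  have hr3 : 2 * r ≤ 1 - ‖w‖ := by
    have : min (dist z w / 2) (min (1 - ‖z‖) (1 - ‖w‖)) ≤ 1 - ‖w‖ :=
      (min_le_right _ _).trans (min_le_right _ _)
    rw [hrdef, k2eps]
    linarith
  have hBz : ball z r ⊆ ball (0 : Euc d) 1 :=
    ball_subset_ball' (by rw [dist_zero_right]; linarith)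
  have hBw : ball w r ⊆ ball (0 : Euc d) 1 :=
    ball_subset_ball' (by rw [dist_zero_right]; linarith)
  have hdz : ∀ t < r, closedBall z t ⊆ (ball w r)ᶜ := fun t ht x hx hx' => by
    have h1 := dist_triangle_left z w x
    rw [mem_closedBall] at hx
    rw [mem_ball] at hx'
    linarith
  have hdw : ∀ t < r, closedBall w t ⊆ (ball z r)ᶜ := fun t ht x hx hx' => by
    have h1 := dist_triangle_left z w x
    rw [mem_closedBall] at hx
    rw [mem_ball] at hx'
    linarith
  obtain ⟨ϕz, hϕz, hz2, -⟩ := X.exists_harmL2 hd hr hBz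
  obtain ⟨ϕw, hϕw, hw2, G, S, hG, hS, hlim⟩ := X.exists_harmL2 hd hr hBw
  have hk : X.k2 z w = inner ℝ ϕz ϕw := by
    rw [k2, L2.inner_def]
    refine integral_congr_ae ?_
    filter_upwards [hϕz, hϕw] with ω h1 h2
    rw [h1, h2]
    simp [mul_comm, ← hrdef]
  have hconst : ∀ n, inner ℝ ϕz (X.toL2 (radial (G n) w))
      = inner ℝ (X.toL2 (radial g z)) (X.toL2 (radial g' w)) := by
    intro n
    have hsz := (hg.tsupport_radial_subset z).trans (hdz s hs)
    rw [← hz2 g s hg hs _ ((hG n).isTestFun_radial w)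
      (((hG n).tsupport_radial_subset w).trans (hdw _ (hS n))), real_inner_comm,
      hw2 _ _ (hG n) (hS n) _ (hg.isTestFun_radial z) hsz,
      ← hw2 _ _ hg' hs' _ (hg.isTestFun_radial z) hsz, real_inner_comm]
  have hl := (tendsto_const_nhds (x := ϕz)).inner (𝕜 := ℝ) hlim
  simp_rw [hconst] at hl
  rw [hk]
  exact tendsto_nhds_unique tendsto_const_nhds hl

lemma norm_toL2_radial_le_centered (hd : 2 ≤ d) {g : ℝ → ℝ} {s : ℝ} (hg : IsProfile d g s)
    {z : Euc d} (hz : ‖z‖ < 1) {ε : ℝ} (hε : 0 < ε) :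
    ‖X.toL2 (radial (dilateProfile d g ε) z)‖ ^ 2
      ≤ ‖X.toL2 (radial (dilateProfile d g (ε / 2)) 0)‖ ^ 2 := by
  have hB : ball (-((1 / 2 : ℝ) • z)) (1 / 2) ⊆ ball (0 : Euc d) 1 := by
    refine ball_subset_ball' ?_
    rw [dist_zero_right, norm_neg, norm_smul]
    norm_num
    linarith
  have hp := (hg.dilate hε).isTestFun_radial z
  have hp' := (hg.dilate (half_pos hε)).isTestFun_radial 0
  have heq : (fun y : Euc d => radial (dilateProfile d g (ε / 2)) 0
      (-((1 / 2 : ℝ) • z) + (1 / 2 : ℝ) • y)) = (2 : ℝ) ^ d • radial (dilateProfile d g ε) z := by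
    ext y
    rw [radial_dilateProfile _ (half_pos hε), Pi.smul_apply, radial_dilateProfile _ hε, smul_eq_mul,
      ← mul_assoc]
    congr 1
    · rw [div_pow]
      field_simp
    · congr 1
      rw [sub_zero, neg_add_eq_sub, ← smul_sub, smul_smul]
      congr 1
      field_simp
  have h1 := X.integral_h_sq (by norm_num) hB hp'
  rw [X.integral_H_sq (by norm_num) hB hp', heq, ← X.norm_toL2_sq hp',
    ← X.norm_toL2_sq (hp.const_smul _), X.toL2_smul hp, norm_smul, mul_pow] at h1
  have h2 : 0 ≤ ∫ ω, X.Φ (-((1 / 2 : ℝ) • z)) (1 / 2) (radial (dilateProfile d g (ε / 2)) 0) ω ^ 2 ∂X.P :=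
    integral_nonneg fun _ => sq_nonneg _
  obtain ⟨k, rfl⟩ := Nat.exists_eq_add_of_le hd
  have h3 : (1 / 2 : ℝ) ^ (2 + (2 + k)) * (‖(2 : ℝ) ^ (2 + k)‖ ^ 2 * ‖X.toL2 (radial (dilateProfile (2 + k) g ε) z)‖ ^ 2)
      = 2 ^ k * ‖X.toL2 (radial (dilateProfile (2 + k) g ε) z)‖ ^ 2 := by
    rw [← mul_assoc]
    congr 1
    rw [Real.norm_of_nonneg (by positivity), one_div, inv_pow]
    field_simp
    ring
  rw [h3] at h1
  have h4 : (1 : ℝ) ≤ 2 ^ k := one_le_pow₀ (by norm_num)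
  nlinarith [sq_nonneg ‖X.toL2 (radial (dilateProfile (2 + k) g ε) z)‖]

lemma norm_toL2_radial_recursion (hd : 2 ≤ d) {g : ℝ → ℝ} (hg : IsProfile d g (1 / 4))
    {δ : ℝ} (hδ : 0 < δ) (hδ1 : δ ≤ 1) :
    δ ^ d * ‖X.toL2 (radial (dilateProfile d g δ) 0)‖ ^ 2
      ≤ δ ^ 2 * ‖X.toL2 (radial g 0)‖ ^ 2
        + (2 * δ) ^ d * ‖X.toL2 (radial (dilateProfile d g (2 * δ)) 0)‖ ^ 2 / 4 := by
  have hB : ball (0 : Euc d) δ ⊆ ball (0 : Euc d) 1 := ball_subset_ball hδ1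
  have h2δ : 0 < 2 * δ := by positivity
  have hp := hg.dilate hδ
  have hp2 := hg.dilate h2δ
  have ht := hp.isTestFun_radial 0
  have ht2 := hp2.isTestFun_radial 0
  have heq : (fun y : Euc d => radial (dilateProfile d g δ) 0 (0 + δ • y))
      = (δ ^ d)⁻¹ • radial g 0 := by
    ext y
    rw [radial_dilateProfile _ hδ, Pi.smul_apply, zero_add, sub_zero, inv_smul_smul₀ hδ.ne',
      smul_eq_mul]
  have h1 := X.integral_h_sq hδ hB ht
  have h2 := X.integral_h_sq hδ hB ht2
  have hΦ : ∫ ω, X.Φ 0 δ (radial (dilateProfile d g δ) 0) ω ^ 2 ∂X.P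
      = ∫ ω, X.Φ 0 δ (radial (dilateProfile d g (2 * δ)) 0) ω ^ 2 ∂X.P := by
    refine integral_congr_ae ?_
    filter_upwards [X.Phi_radial_ae_eq hδ hB hp (by linarith),
      X.Phi_radial_ae_eq hδ hB hp2 (by linarith)] with ω h1 h2
    rw [h1, h2]
  have h3 : 0 ≤ ∫ ω, X.H 0 δ (radial (dilateProfile d g (2 * δ)) 0) ω ^ 2 ∂X.P :=
    integral_nonneg fun _ => sq_nonneg _
  have hg1 := hg.isTestFun_radial (0 : Euc d)
  rw [X.integral_H_sq hδ hB ht, heq, ← X.norm_toL2_sq ht,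
    ← X.norm_toL2_sq (hg1.const_smul _), X.toL2_smul hg1, norm_smul, mul_pow] at h1
  rw [← X.norm_toL2_sq ht2] at h2
  have h4 : ‖X.toL2 (radial (dilateProfile d g δ) 0)‖ ^ 2
      ≤ δ ^ (2 + d) * (‖(δ ^ d)⁻¹‖ ^ 2 * ‖X.toL2 (radial g 0)‖ ^ 2)
        + ‖X.toL2 (radial (dilateProfile d g (2 * δ)) 0)‖ ^ 2 := by linarith
  have hδd : 0 < δ ^ d := by positivity
  have h5 := mul_le_mul_of_nonneg_left h4 hδd.le
  have h6 : δ ^ d * (δ ^ (2 + d) * (‖(δ ^ d)⁻¹‖ ^ 2 * ‖X.toL2 (radial g 0)‖ ^ 2))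
      = δ ^ 2 * ‖X.toL2 (radial g 0)‖ ^ 2 := by
    rw [Real.norm_of_nonneg (by positivity), pow_add]
    field_simp
  have h7 : (4 : ℝ) ≤ 2 ^ d := by
    calc (4 : ℝ) = 2 ^ 2 := by norm_num
      _ ≤ 2 ^ d := pow_le_pow_right₀ (by norm_num) hd
  rw [mul_add, h6] at h5
  rw [mul_pow]
  have h8 : 0 ≤ δ ^ d * ‖X.toL2 (radial (dilateProfile d g (2 * δ)) 0)‖ ^ 2 := by positivity
  nlinarith

/-- The variance of the field tested against a radial mollifier at scale `ε = 2⁻ⁿ` is `o(ε^{-d})`,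
uniformly in the centre of the mollifier. -/
lemma exists_norm_toL2_radial_le (hd : 2 ≤ d) {g : ℝ → ℝ} (hg : IsProfile d g (1 / 4)) :
    ∃ C : ℝ, 0 ≤ C ∧ ∀ (n : ℕ) (z : Euc d), ‖z‖ < 1 →
      ((1 / 2 : ℝ) ^ n) ^ d * ‖X.toL2 (radial (dilateProfile d g ((1 / 2) ^ n)) z)‖ ^ 2
        ≤ C * (1 / 2) ^ n := by
  set u : ℕ → ℝ := fun n => ((1 / 2 : ℝ) ^ n) ^ d *
    ‖X.toL2 (radial (dilateProfile d g ((1 / 2) ^ n)) 0)‖ ^ 2 with hu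
  set c := ‖X.toL2 (radial g 0)‖ ^ 2 with hc
  have hu0 : 0 ≤ u 0 := by positivity
  have hc0 : 0 ≤ c := by positivity
  have hrec : ∀ n, u (n + 1) ≤ ((1 / 2 : ℝ) ^ (n + 1)) ^ 2 * c + u n / 4 := by
    intro n
    have h := X.norm_toL2_radial_recursion hd hg (δ := (1 / 2 : ℝ) ^ (n + 1)) (by positivity)
      (pow_le_one₀ (by norm_num) (by norm_num))
    have h2 : 2 * (1 / 2 : ℝ) ^ (n + 1) = (1 / 2) ^ n := by rw [pow_succ]; ring
    rwa [h2] at h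
  have hdecay : ∀ n, u n ≤ (c + u 0) * (1 / 2) ^ n := by
    intro n
    induction n with
    | zero => simp [hc0]
    | succ n ih =>
      have hx : 0 < (1 / 2 : ℝ) ^ n := by positivity
      have hx1 : (1 / 2 : ℝ) ^ n ≤ 1 := pow_le_one₀ (by norm_num) (by norm_num)
      have h := hrec n
      rw [pow_succ (1 / 2 : ℝ) n] at h ⊢
      set x := (1 / 2 : ℝ) ^ n
      have h3 : x * x * c ≤ x * c := by nlinarith [mul_nonneg hx.le hc0]
      nlinarith [mul_nonneg hx.le hu0]
  refine ⟨2 ^ d * (c + u 0), by positivity, fun n z hz => ?_⟩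
  have hε : (0 : ℝ) < (1 / 2) ^ n := by positivity
  have h1 := X.norm_toL2_radial_le_centered hd hg hz hε
  have h2 : (1 / 2 : ℝ) ^ n / 2 = (1 / 2) ^ (n + 1) := by rw [pow_succ]; ring
  rw [h2] at h1
  have h3 := hdecay (n + 1)
  calc ((1 / 2 : ℝ) ^ n) ^ d * ‖X.toL2 (radial (dilateProfile d g ((1 / 2) ^ n)) z)‖ ^ 2
      ≤ ((1 / 2 : ℝ) ^ n) ^ d * ‖X.toL2 (radial (dilateProfile d g ((1 / 2) ^ (n + 1))) 0)‖ ^ 2 := by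
        gcongr
    _ = 2 ^ d * u (n + 1) := by
        simp only [hu]
        rw [← mul_assoc, ← mul_pow, pow_succ]
        congr 2
        ring
    _ ≤ 2 ^ d * ((c + u 0) * (1 / 2) ^ (n + 1)) := by gcongr
    _ ≤ 2 ^ d * (c + u 0) * (1 / 2) ^ n := by
        rw [pow_succ, ← mul_assoc]
        have : 0 ≤ 2 ^ d * (c + u 0) * (1 / 2) ^ n := by positivity
        nlinarith

end GFF

lemma iteratedFDeriv_integral_smul_comp_sub {d : ℕ} {φ : Euc d → ℝ} (hφ : LocallyIntegrable φ)
    {f : Euc d → ℝ} (hf : IsTestFun f) (m : ℕ) :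
    iteratedFDeriv ℝ m (fun x => ∫ y, φ y • f (x - y))
      = fun x => ∫ y, φ y • iteratedFDeriv ℝ m f (x - y) := by
  have key : ∀ {F : Type} [NormedAddCommGroup F] [NormedSpace ℝ F] {u : Euc d → F},
      ContDiff ℝ 1 u → HasCompactSupport u → ∀ x,
      HasFDerivAt (fun x => ∫ y, φ y • u (x - y)) (∫ y, φ y • fderiv ℝ u (x - y)) x := by
    intro F _ _ u hu hus x
    exact hus.hasFDerivAt_convolution_right (ContinuousLinearMap.lsmul ℝ ℝ) hφ hu x
  induction m with
  | zero =>
    ext1 x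
    have h := ((continuousMultilinearCurryFin0 ℝ (Euc d) ℝ).symm.toContinuousLinearEquiv).integral_comp_comm
      (fun y => φ y • f (x - y)) (μ := volume)
    simp_rw [map_smul] at h
    exact h.symm
  | succ m ih =>
    have hc : ContDiff ℝ 1 (iteratedFDeriv ℝ m f) :=
      hf.1.iteratedFDeriv_right (by exact_mod_cast le_top)
    rw [iteratedFDeriv_succ_eq_comp_left, ih, iteratedFDeriv_succ_eq_comp_left]
    ext1 x
    have h := ContinuousLinearEquiv.integral_comp_comm (𝕜 := ℝ) (E := Euc d →L[ℝ] Euc d [×m]→L[ℝ] ℝ)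
      (F := Euc d [×(m+1)]→L[ℝ] ℝ)
      ((continuousMultilinearCurryLeftEquiv ℝ (fun _ : Fin (m + 1) => Euc d)
      ℝ).symm.toContinuousLinearEquiv)
      (fun y => φ y • fderiv ℝ (iteratedFDeriv ℝ m f) (x - y)) (μ := volume)
    simp_rw [map_smul] at h
    rw [Function.comp_apply, (key hc (hf.2.iteratedFDeriv m) x).fderiv]
    exact h.symm

lemma exists_simpleFunc_approx {d : ℕ} {S : Set (Euc d)} (hS : IsCompact S) :
    ∃ π : ℕ → SimpleFunc (Euc d) (Euc d), ∀ ε > 0, ∀ᶠ k in atTop, ∀ z ∈ S, dist (π k z) z < ε := by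
  refine ⟨SimpleFunc.nearestPt (TopologicalSpace.denseSeq (Euc d)), fun ε hε => ?_⟩
  set e := TopologicalSpace.denseSeq (Euc d)
  obtain ⟨t, ht⟩ := hS.elim_finite_subcover (fun i => ball (e i) ε) (fun _ => isOpen_ball)
    (fun z _ => by
      obtain ⟨i, hi⟩ := (TopologicalSpace.denseRange_denseSeq (Euc d)).exists_dist_lt z hε
      exact mem_iUnion.2 ⟨i, hi⟩)
  filter_upwards [eventually_ge_atTop (t.sup id)] with k hk z hz
  obtain ⟨i, hi, hzi⟩ := mem_iUnion₂.1 (ht hz)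
  have h := SimpleFunc.edist_nearestPt_le e z ((Finset.le_sup (f := id) hi).trans hk)
  rw [edist_dist, edist_dist, ENNReal.ofReal_le_ofReal_iff dist_nonneg] at h
  rw [mem_ball, dist_comm] at hzi
  exact h.trans_lt hzi

lemma integrable_comp_simpleFunc {α β E : Type*} [MeasurableSpace α] [MeasurableSpace β]
    [NormedAddCommGroup E] (μ : Measure α) [IsFiniteMeasure μ] (π : SimpleFunc α β) (q : β → E) :
    Integrable (fun z => q (π z)) μ :=
  SimpleFunc.integrable_of_isFiniteMeasure (π.map q)

lemma integral_comp_simpleFunc {α β E : Type*} [MeasurableSpace α]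
    [NormedAddCommGroup E] [NormedSpace ℝ E] [CompleteSpace E] (μ : Measure α) [IsFiniteMeasure μ]
    (π : SimpleFunc α β) (q : β → E) :
    ∫ z, q (π z) ∂μ = ∑ y ∈ π.range, μ.real (π ⁻¹' {y}) • q y := by
  classical
  have h : ∀ z, q (π z) = ∑ y ∈ π.range, (π ⁻¹' {y}).indicator (fun _ => q y) z := by
    intro z
    rw [Finset.sum_eq_single_of_mem (π z) (π.mem_range_self z)]
    · simp
    · intro y _ hy
      exact indicator_of_notMem (fun h => hy (by simpa using h.symm)) _
  simp_rw [h]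
  rw [integral_finsetSum]
  · simp_rw [integral_indicator_const _ (π.measurableSet_preimage _)]
  · exact fun y _ => (integrable_const _).indicator (π.measurableSet_preimage _)

/-- A family `p` of test functions supported in `K`, depending continuously (in the topology of
uniform convergence of all derivatives) on a parameter and vanishing for parameters outside `S`. -/
structure SmoothFamily {d : ℕ} (p : Euc d → Euc d → ℝ) (S K : Set (Euc d)) : Prop where
  isTestFun : ∀ z, IsTestFun (p z)
  tsupport_subset : ∀ z, tsupport (p z) ⊆ K
  eq_zero : ∀ z ∉ S, p z = 0
  unif : ∀ (m : ℕ), ∀ ε > 0, ∃ δ > 0, ∀ z z', dist z z' < δ → ∀ x,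
    ‖iteratedFDeriv ℝ m (p z) x - iteratedFDeriv ℝ m (p z') x‖ ≤ ε

lemma IsTestFun.sum_smul {d : ℕ} {ι : Type*} {p : ι → Euc d → ℝ} (hp : ∀ i, IsTestFun (p i))
    (s : Finset ι) (c : ι → ℝ) : IsTestFun (∑ i ∈ s, c i • p i) := by
  classical
  induction s using Finset.induction_on with
  | empty => exact ⟨contDiff_const, HasCompactSupport.zero⟩
  | insert i s hi ih =>
    rw [Finset.sum_insert hi]
    exact ((hp i).const_smul _).add ih

namespace GFF

variable {d : ℕ} {Ω : Type} [MeasurableSpace Ω] (X : GFF d Ω)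

lemma toL2_zero : X.toL2 0 = 0 := by
  have h0 : IsTestFun (0 : Euc d → ℝ) := ⟨contDiff_const, HasCompactSupport.zero⟩
  have h := X.toL2_smul h0 0
  simpa using h

lemma toL2_sum_smul {ι : Type*} {p : ι → Euc d → ℝ} (hp : ∀ i, IsTestFun (p i))
    (s : Finset ι) (c : ι → ℝ) :
    X.toL2 (∑ i ∈ s, c i • p i) = ∑ i ∈ s, c i • X.toL2 (p i) := by
  classical
  induction s using Finset.induction_on with
  | empty => simpa using X.toL2_zero
  | insert i s hi ih =>
    rw [Finset.sum_insert hi, Finset.sum_insert hi,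
      X.toL2_add ((hp i).const_smul _) (IsTestFun.sum_smul hp s c), ih, X.toL2_smul (hp i)]

lemma tendsto_inner_toL2 {f : ℕ → Euc d → ℝ} {f₀ g : Euc d → ℝ} {K : Set (Euc d)}
    (hK : IsCompact K) (hKB : K ⊆ ball (0 : Euc d) 1) (hf : ∀ n, IsTestFun (f n))
    (hf₀ : IsTestFun f₀) (hg : IsTestFun g) (hgB : tsupport g ⊆ ball (0 : Euc d) 1)
    (hfK : ∀ n, tsupport (f n) ⊆ K) (hf₀K : tsupport f₀ ⊆ K)
    (h : ∀ m : ℕ, TendstoUniformly (fun n => iteratedFDeriv ℝ m (f n)) (iteratedFDeriv ℝ m f₀)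
      atTop) :
    Tendsto (fun n => inner ℝ (X.toL2 (f n)) (X.toL2 g)) atTop
      (𝓝 (inner ℝ (X.toL2 f₀) (X.toL2 g))) := by
  simp_rw [fun n => X.inner_toL2 (hf n) hg, X.inner_toL2 hf₀ hg]
  exact X.K2_cont f f₀ g K hK hKB hf hf₀ hg hgB hfK hf₀K h

variable {p : Euc d → Euc d → ℝ} {S K : Set (Euc d)} {g : Euc d → ℝ}

lemma continuous_inner_toL2 (hp : SmoothFamily p S K) (hK : IsCompact K)
    (hKB : K ⊆ ball (0 : Euc d) 1) (hg : IsTestFun g) (hgB : tsupport g ⊆ ball (0 : Euc d) 1) :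
    Continuous fun z => inner ℝ (X.toL2 (p z)) (X.toL2 g) := by
  refine continuous_iff_seqContinuous.2 fun u z hu => ?_
  refine X.tendsto_inner_toL2 hK hKB (fun n => hp.isTestFun _) (hp.isTestFun z) hg hgB
    (fun n => hp.tsupport_subset _) (hp.tsupport_subset z) fun m => ?_
  rw [Metric.tendstoUniformly_iff]
  intro ε hε
  obtain ⟨δ, hδ, h⟩ := hp.unif m (ε / 2) (half_pos hε)
  filter_upwards [Metric.tendsto_nhds.1 hu δ hδ] with n hn x
  rw [dist_eq_norm]
  exact (h _ _ (by rwa [dist_comm]) x).trans_lt (half_lt_self hε)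

lemma integral_inner_toL2 (hp : SmoothFamily p S K) (hK : IsCompact K)
    (hKB : K ⊆ ball (0 : Euc d) 1) (hg : IsTestFun g) (hgB : tsupport g ⊆ ball (0 : Euc d) 1)
    (hS : IsCompact S) {F : Euc d → ℝ} (hF : IsTestFun F)
    (hFK : tsupport F ⊆ K)
    (hFp : ∀ m x, iteratedFDeriv ℝ m F x = ∫ z, iteratedFDeriv ℝ m (p z) x) :
    ∫ z, inner ℝ (X.toL2 (p z)) (X.toL2 g) = inner ℝ (X.toL2 F) (X.toL2 g) := by
  obtain ⟨π, hπ⟩ := exists_simpleFunc_approx hS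
  set μ : Measure (Euc d) := volume.restrict S with hμ
  have hfin : IsFiniteMeasure μ := ⟨by rw [hμ, Measure.restrict_apply_univ]; exact hS.measure_lt_top⟩
  have hμu : μ.real univ = volume.real S := by rw [hμ, measureReal_restrict_apply_univ]
  have hmS : MeasurableSet S := hS.measurableSet
  set R : ℕ → Euc d → ℝ := fun k => ∑ y ∈ (π k).range, μ.real (π k ⁻¹' {y}) • p y with hR
  have hRt : ∀ k, IsTestFun (R k) := fun k => IsTestFun.sum_smul hp.isTestFun _ _
  have hRK : ∀ k, tsupport (R k) ⊆ K := by
    intro k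
    refine closure_minimal (fun x hx => ?_) hK.isClosed
    by_contra hxK
    refine hx ?_
    simp only [hR, Finset.sum_apply, Pi.smul_apply]
    refine Finset.sum_eq_zero fun y _ => ?_
    rw [image_eq_zero_of_notMem_tsupport fun h => hxK (hp.tsupport_subset y h), smul_zero]
  have hRD : ∀ k m x, iteratedFDeriv ℝ m (R k) x = ∫ z, iteratedFDeriv ℝ m (p (π k z)) x ∂μ := by
    intro k m x
    have hc : ∀ y, ContDiffAt ℝ m (p y) x := fun y =>
      ((hp.isTestFun y).1.of_le (by exact_mod_cast le_top)).contDiffAt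
    rw [integral_comp_simpleFunc μ (π k) (fun y => iteratedFDeriv ℝ m (p y) x)]
    have hc' : ∀ y ∈ (π k).range, ContDiffAt ℝ m (μ.real (π k ⁻¹' {y}) • p y) x :=
      fun y _ => (((hp.isTestFun y).const_smul _).1.of_le (by exact_mod_cast le_top)).contDiffAt
    refine (iteratedFDeriv_sum_apply hc').trans ?_
    exact Finset.sum_congr rfl fun y _ => iteratedFDeriv_const_smul_apply (hc y)
  have hcont : ∀ m x, Continuous fun z => iteratedFDeriv ℝ m (p z) x := by
    intro m x
    refine Metric.continuous_iff.2 fun z ε hε => ?_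
    obtain ⟨δ, hδ, h⟩ := hp.unif m (ε / 2) (half_pos hε)
    refine ⟨δ, hδ, fun w hw => ?_⟩
    rw [dist_eq_norm]
    exact (h _ _ hw x).trans_lt (half_lt_self hε)
  have hFD : ∀ m x, iteratedFDeriv ℝ m F x = ∫ z, iteratedFDeriv ℝ m (p z) x ∂μ := by
    intro m x
    rw [hFp, setIntegral_eq_integral_of_forall_compl_eq_zero]
    intro z hz
    rw [hp.eq_zero z hz, iteratedFDeriv_zero]
    rfl
  have hlim := X.tendsto_inner_toL2 hK hKB hRt hF hg hgB hRK hFK fun m => by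
    rw [Metric.tendstoUniformly_iff]
    intro ε hε
    obtain ⟨δ, hδ, h⟩ := hp.unif m (ε / (μ.real univ + 1)) (by positivity)
    filter_upwards [hπ δ hδ] with k hk x
    rw [dist_comm, dist_eq_norm, hRD, hFD, ← integral_sub (integrable_comp_simpleFunc μ (π k)
      (fun y => iteratedFDeriv ℝ m (p y) x)) ((hcont m x).continuousOn.integrableOn_compact hS)]
    refine (norm_setIntegral_le_of_norm_le_const hS.measure_lt_top
      (C := ε / (μ.real univ + 1)) fun z hz => h _ _ (hk z hz) x).trans_lt ?_
    rw [← hμu, div_mul_eq_mul_div, div_lt_iff₀ (by positivity)]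
    nlinarith
  set q : Euc d → ℝ := fun z => inner ℝ (X.toL2 (p z)) (X.toL2 g) with hq
  have hqc : Continuous q := X.continuous_inner_toL2 hp hK hKB hg hgB
  have hq0 : ∀ z ∉ S, q z = 0 := fun z hz => by
    simp only [hq, hp.eq_zero z hz, X.toL2_zero, inner_zero_left]
  have hqs : HasCompactSupport q := HasCompactSupport.intro hS hq0
  obtain ⟨C, hC⟩ := hqs.exists_bound_of_continuous hqc
  have hRq : ∀ k, inner ℝ (X.toL2 (R k)) (X.toL2 g) = ∫ z, q (π k z) ∂μ := by
    intro k
    rw [integral_comp_simpleFunc, X.toL2_sum_smul hp.isTestFun, sum_inner]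
    exact Finset.sum_congr rfl fun y _ => real_inner_smul_left _ _ _
  simp_rw [hRq] at hlim
  have hlim2 : Tendsto (fun k => ∫ z, q (π k z) ∂μ) atTop (𝓝 (∫ z, q z ∂μ)) := by
    refine tendsto_integral_of_dominated_convergence (fun _ => C)
      (fun k => (integrable_comp_simpleFunc μ (π k) q).aestronglyMeasurable) (integrable_const _)
      (fun k => Eventually.of_forall fun z => hC _) ?_
    refine (ae_restrict_iff' hmS).2 (Eventually.of_forall fun z hz => ?_)
    refine (hqc.tendsto z).comp (Metric.tendsto_nhds.2 fun ε hε => ?_)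
    filter_upwards [hπ ε hε] with k hk using hk z hz
  rw [← tendsto_nhds_unique hlim2 hlim, setIntegral_eq_integral_of_forall_compl_eq_zero hq0]

end GFF

/-- The convolution of `f` with the radial function of profile `g`. -/
def mollify {d : ℕ} (g : ℝ → ℝ) (f : Euc d → ℝ) : Euc d → ℝ := fun x => ∫ z, f z * radial g z x

lemma radial_eq_comp_sub {d : ℕ} (g : ℝ → ℝ) (z x : Euc d) :
    radial g z x = radial g 0 (x - z) := by
  simp [radial]

lemma iteratedFDeriv_smul_radial {d : ℕ} {g : ℝ → ℝ} {s : ℝ} (hg : IsProfile d g s)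
    (c : ℝ) (z : Euc d) (m : ℕ) (x : Euc d) :
    iteratedFDeriv ℝ m (c • radial g z) x = c • iteratedFDeriv ℝ m (radial g 0) (x - z) := by
  rw [iteratedFDeriv_const_smul_apply
    ((hg.contDiff_radial z).of_le (by exact_mod_cast le_top)).contDiffAt]
  congr 1
  have h : radial g z = fun x => radial g 0 (x - z) := funext (radial_eq_comp_sub g z)
  rw [h, iteratedFDeriv_comp_sub]

section Mollify

variable {d : ℕ} {g : ℝ → ℝ} {s ρ : ℝ} {f : Euc d → ℝ}

lemma tsupport_smul_radial_subset (hg : IsProfile d g s) (hfρ : tsupport f ⊆ closedBall 0 ρ)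
    (z : Euc d) : tsupport (f z • radial g z) ⊆ closedBall (0 : Euc d) (ρ + s) := by
  refine closure_minimal (fun x hx => ?_) isClosed_closedBall
  have hx' : f z * radial g z x ≠ 0 := hx
  have h1 : ‖z‖ ≤ ρ := by
    simpa using hfρ (subset_tsupport f (left_ne_zero_of_mul hx'))
  have h2 : dist x z ≤ s := by
    by_contra h
    exact right_ne_zero_of_mul hx' (hg.radial_eq_zero h)
  rw [mem_closedBall_zero_iff]
  have h3 := norm_sub_norm_le x z
  rw [dist_eq_norm] at h2
  linarith

lemma smoothFamily_smul_radial (hg : IsProfile d g s) (hf : IsTestFun f)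
    (hfρ : tsupport f ⊆ closedBall 0 ρ) :
    SmoothFamily (fun z => f z • radial g z) (closedBall 0 ρ) (closedBall 0 (ρ + s)) where
  isTestFun z := (hg.isTestFun_radial z).const_smul _
  tsupport_subset := tsupport_smul_radial_subset hg hfρ
  eq_zero z hz := by
    simp only [image_eq_zero_of_notMem_tsupport fun h => hz (hfρ h), zero_smul]
  unif m ε hε := by
    have hψ := hg.isTestFun_radial (0 : Euc d)
    set D := iteratedFDeriv ℝ m (radial g (0 : Euc d)) with hD
    have hDc : Continuous D := hψ.1.continuous_iteratedFDeriv (by exact_mod_cast le_top)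
    set q : Euc d × Euc d → Euc d [×m]→L[ℝ] ℝ := fun y => f y.1 • D (y.2 - y.1) with hq
    have hqc : Continuous q :=
      (hf.1.continuous.comp continuous_fst).smul (hDc.comp (continuous_snd.sub continuous_fst))
    have hqs : HasCompactSupport q := by
      refine HasCompactSupport.intro
        ((isCompact_closedBall (0 : Euc d) ρ).prod (isCompact_closedBall (0 : Euc d) (ρ + s))) ?_
      rintro ⟨z, x⟩ hzx
      by_contra hne
      refine hzx ?_
      have h1 : z ∈ closedBall (0 : Euc d) ρ := hfρ (subset_tsupport f (left_ne_zero_of_smul hne))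
      have h2 : x - z ∈ closedBall (0 : Euc d) s :=
        hg.tsupport_radial_subset 0 (support_iteratedFDeriv_subset m (right_ne_zero_of_smul hne))
      refine ⟨h1, ?_⟩
      rw [mem_closedBall_zero_iff] at *
      have h3 := norm_sub_norm_le x z
      linarith
    obtain ⟨δ, hδ, h⟩ := Metric.uniformContinuous_iff.1
      (hqs.uniformContinuous_of_continuous hqc) ε hε
    refine ⟨δ, hδ, fun z z' hz x => ?_⟩
    rw [iteratedFDeriv_smul_radial hg, iteratedFDeriv_smul_radial hg,
      ← dist_eq_norm]
    exact (h (a := (z, x)) (b := (z', x)) (by simpa [Prod.dist_eq] using hz)).le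

lemma mollify_eq (g : ℝ → ℝ) (f : Euc d → ℝ) :
    mollify g f = fun x => ∫ z, f z • radial g 0 (x - z) := by
  ext x
  simp_rw [mollify, radial_eq_comp_sub g _ x, smul_eq_mul]

lemma mollify_eq_swap (g : ℝ → ℝ) (f : Euc d → ℝ) :
    mollify g f = fun x => ∫ y, radial g 0 y • f (x - y) := by
  rw [mollify_eq]
  ext x
  rw [← integral_sub_left_eq_self _ volume x]
  simp_rw [sub_sub_cancel, smul_eq_mul, mul_comm]

lemma tsupport_mollify_subset (hg : IsProfile d g s) (hfρ : tsupport f ⊆ closedBall 0 ρ) :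
    tsupport (mollify g f) ⊆ closedBall (0 : Euc d) (ρ + s) := by
  refine closure_minimal (fun x hx => ?_) isClosed_closedBall
  by_contra hxK
  refine hx (integral_eq_zero_of_ae (Eventually.of_forall fun z => ?_))
  exact image_eq_zero_of_notMem_tsupport
    (f := f z • radial g z) fun h => hxK (tsupport_smul_radial_subset hg hfρ z h)

lemma isTestFun_mollify (hg : IsProfile d g s) (hf : IsTestFun f)
    (hfρ : tsupport f ⊆ closedBall 0 ρ) : IsTestFun (mollify g f) := by
  have hψ := hg.isTestFun_radial (0 : Euc d)
  refine ⟨?_, HasCompactSupport.of_support_subset_isCompact (isCompact_closedBall _ _)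
    ((subset_tsupport _).trans (tsupport_mollify_subset hg hfρ))⟩
  rw [mollify_eq]
  exact hψ.2.contDiff_convolution_right (ContinuousLinearMap.lsmul ℝ ℝ)
    (hf.1.continuous.locallyIntegrable (μ := volume)) hψ.1

lemma iteratedFDeriv_mollify (hg : IsProfile d g s) (hf : IsTestFun f) (m : ℕ) (x : Euc d) :
    iteratedFDeriv ℝ m (mollify g f) x = ∫ z, iteratedFDeriv ℝ m (f z • radial g z) x := by
  rw [mollify_eq, iteratedFDeriv_integral_smul_comp_sub hf.1.continuous.locallyIntegrable
    (hg.isTestFun_radial 0)]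
  simp_rw [iteratedFDeriv_smul_radial hg]

lemma iteratedFDeriv_mollify_sub (hg : IsProfile d g s) (hf : IsTestFun f) (m : ℕ) (x : Euc d) :
    iteratedFDeriv ℝ m (mollify g f) x - iteratedFDeriv ℝ m f x
      = ∫ y, radial g 0 y • (iteratedFDeriv ℝ m f (x - y) - iteratedFDeriv ℝ m f x) := by
  have hψ := hg.isTestFun_radial (0 : Euc d)
  have hDc : Continuous (iteratedFDeriv ℝ m f) :=
    hf.1.continuous_iteratedFDeriv (by exact_mod_cast le_top)
  have hint : ∀ {u : Euc d → Euc d [×m]→L[ℝ] ℝ}, Continuous u →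
      Integrable (fun y => radial g 0 y • u y) := fun hu =>
    (hψ.1.continuous.smul hu).integrable_of_hasCompactSupport hψ.2.smul_right
  simp_rw [smul_sub]
  rw [integral_sub (hint (u := fun y => iteratedFDeriv ℝ m f (x - y))
    (hDc.comp (continuous_const.sub continuous_id))) (hint continuous_const),
    integral_smul_const, mollify_eq_swap,
    iteratedFDeriv_integral_smul_comp_sub hψ.1.continuous.locallyIntegrable hf]
  have h1 : ∫ y : Euc d, radial g 0 y = 1 := by
    rw [integral_radial]
    exact hg.integral_eq_one
  rw [h1, one_smul]

lemma tendstoUniformly_iteratedFDeriv_mollify {g : ℕ → ℝ → ℝ} {s : ℕ → ℝ}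
    (hg : ∀ n, IsProfile d (g n) (s n)) (hg0 : ∀ n t, 0 ≤ g n t) (hs : Tendsto s atTop (𝓝 0))
    (hf : IsTestFun f) (m : ℕ) :
    TendstoUniformly (fun n => iteratedFDeriv ℝ m (mollify (g n) f)) (iteratedFDeriv ℝ m f)
      atTop := by
  have hDc : Continuous (iteratedFDeriv ℝ m f) :=
    hf.1.continuous_iteratedFDeriv (by exact_mod_cast le_top)
  rw [Metric.tendstoUniformly_iff]
  intro ε hε
  obtain ⟨δ, hδ, h⟩ := Metric.uniformContinuous_iff.1
    ((hf.2.iteratedFDeriv m).uniformContinuous_of_continuous hDc) (ε / 2) (half_pos hε)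
  filter_upwards [hs.eventually_lt_const hδ] with n hn x
  have hψ := (hg n).isTestFun_radial (0 : Euc d)
  rw [dist_comm, dist_eq_norm, iteratedFDeriv_mollify_sub (hg n) hf]
  have hle : ∀ y, ‖radial (g n) 0 y • (iteratedFDeriv ℝ m f (x - y) - iteratedFDeriv ℝ m f x)‖
      ≤ radial (g n) 0 y * (ε / 2) := by
    intro y
    have h0 : 0 ≤ radial (g n) 0 y := hg0 n _
    rw [norm_smul, Real.norm_of_nonneg h0]
    by_cases hy : y ∈ closedBall (0 : Euc d) (s n)
    · refine mul_le_mul_of_nonneg_left ?_ h0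
      rw [← dist_eq_norm]
      refine (h ?_).le
      rw [dist_eq_norm, sub_sub_cancel_left, norm_neg]
      exact (mem_closedBall_zero_iff.1 hy).trans_lt hn
    · rw [(hg n).radial_eq_zero hy, zero_mul, zero_mul]
  refine (norm_integral_le_of_norm_le
    ((hψ.1.continuous.integrable_of_hasCompactSupport hψ.2).mul_const _)
    (Eventually.of_forall hle)).trans_lt ?_
  rw [integral_mul_const, integral_radial, (hg n).integral_eq_one, one_mul]
  exact half_lt_self hε

end Mollify

namespace GFF

variable {d : ℕ} {Ω : Type} [MeasurableSpace Ω] (X : GFF d Ω) {g : ℝ → ℝ} {s ρ : ℝ}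
    {f h : Euc d → ℝ}

lemma continuous_mul_inner_radial (hg : IsProfile d g s) (hf : IsTestFun f)
    (hfρ : tsupport f ⊆ closedBall 0 ρ) (hsρ : ρ + s < 1) (hh : IsTestFun h)
    (hhB : tsupport h ⊆ ball (0 : Euc d) 1) :
    Continuous fun z => f z * inner ℝ (X.toL2 (radial g z)) (X.toL2 h) := by
  have hc := X.continuous_inner_toL2 (smoothFamily_smul_radial hg hf hfρ)
    (isCompact_closedBall _ _) (closedBall_subset_ball hsρ) hh hhB
  simp_rw [fun z => X.toL2_smul (hg.isTestFun_radial z) (f z), real_inner_smul_left] at hc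
  exact hc

lemma integral_mul_inner_radial (hg : IsProfile d g s) (hf : IsTestFun f)
    (hfρ : tsupport f ⊆ closedBall 0 ρ) (hsρ : ρ + s < 1) (hh : IsTestFun h)
    (hhB : tsupport h ⊆ ball (0 : Euc d) 1) :
    ∫ z, f z * inner ℝ (X.toL2 (radial g z)) (X.toL2 h)
      = inner ℝ (X.toL2 (mollify g f)) (X.toL2 h) := by
  have hc := X.integral_inner_toL2 (smoothFamily_smul_radial hg hf hfρ)
    (isCompact_closedBall _ _) (closedBall_subset_ball hsρ) hh hhB (isCompact_closedBall _ _)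
    (isTestFun_mollify hg hf hfρ) (tsupport_mollify_subset hg hfρ)
    (iteratedFDeriv_mollify hg hf)
  simp_rw [fun z => X.toL2_smul (hg.isTestFun_radial z) (f z), real_inner_smul_left] at hc
  exact hc

end GFF

lemma abs_integral_le_of_closedBall {d : ℕ} {u : Euc d → ℝ} {M r : ℝ} {z : Euc d} (hr : 0 ≤ r)
    (hM : ∀ w, |u w| ≤ M) (hu : ∀ w ∉ closedBall z r, u w = 0) :
    |∫ w, u w| ≤ M * (r ^ d * volume.real (ball (0 : Euc d) 1)) := by
  rw [← setIntegral_eq_integral_of_forall_compl_eq_zero hu]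
  have h := norm_setIntegral_le_of_norm_le_const (μ := volume) (f := u)
    (isCompact_closedBall z r).measure_lt_top (C := M) (fun w _ => hM w)
  rwa [Measure.addHaar_real_closedBall _ _ hr, finrank_euclideanSpace_fin] at h

lemma abs_real_inner_le_of_norm_sq_le {H : Type*} [NormedAddCommGroup H] [InnerProductSpace ℝ H]
    {x y : H} {M : ℝ} (hx : ‖x‖ ^ 2 ≤ M) (hy : ‖y‖ ^ 2 ≤ M) : |inner ℝ x y| ≤ M := by
  have h := abs_real_inner_le_norm x y
  nlinarith [two_mul_le_add_sq ‖x‖ ‖y‖]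

lemma lt_k2eps {d : ℕ} {z w : Euc d} {ε ρ : ℝ} (hε : 0 < ε) (hερ : ε ≤ 1 - ρ) (hz : ‖z‖ ≤ ρ)
    (hw : ‖w‖ ≤ ρ) (hzw : ε < dist z w) : ε * (1 / 4) < k2eps z w := by
  have h : ε / 2 < min (dist z w / 2) (min (1 - ‖z‖) (1 - ‖w‖)) :=
    lt_min (by linarith) (lt_min (by linarith) (by linarith))
  rw [k2eps]
  linarith

lemma IsTestFun.exists_abs_le {d : ℕ} {f : Euc d → ℝ} (hf : IsTestFun f) :
    ∃ A, 0 ≤ A ∧ ∀ x, |f x| ≤ A := by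
  obtain ⟨A, hA⟩ := hf.2.exists_bound_of_continuous hf.1.continuous
  exact ⟨A, (norm_nonneg _).trans (hA 0), hA⟩

namespace GFF

variable {d : ℕ} {Ω : Type} [MeasurableSpace Ω] (X : GFF d Ω)

/-- The field averaged around `z` at scale `2⁻ⁿ`. -/
def average (g : ℝ → ℝ) (n : ℕ) (z : Euc d) : Lp ℝ 2 X.P :=
  X.toL2 (radial (dilateProfile d g ((1 / 2) ^ n)) z)

variable {g : ℝ → ℝ} {ρ : ℝ} {f h : Euc d → ℝ}

lemma isProfile_dilate_half (hg : IsProfile d g (1 / 4)) (n : ℕ) :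
    IsProfile d (dilateProfile d g ((1 / 2) ^ n)) ((1 / 2) ^ n * (1 / 4)) :=
  hg.dilate (by positivity)

lemma isTestFun_average (hg : IsProfile d g (1 / 4)) (n : ℕ) (z : Euc d) :
    IsTestFun (radial (dilateProfile d g ((1 / 2) ^ n)) z) :=
  (isProfile_dilate_half hg n).isTestFun_radial z

lemma tsupport_average_subset (hg : IsProfile d g (1 / 4))
    {n : ℕ} (hn : (1 / 2 : ℝ) ^ n ≤ 1 - ρ) {z : Euc d} (hz : ‖z‖ ≤ ρ) :
    tsupport (radial (dilateProfile d g ((1 / 2) ^ n)) z) ⊆ ball (0 : Euc d) 1 := by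
  refine ((isProfile_dilate_half hg n).tsupport_radial_subset z).trans
    (closedBall_subset_ball' ?_)
  have h0 : (0 : ℝ) < (1 / 2) ^ n := by positivity
  rw [dist_zero_right]
  linarith

lemma inner_average (hg : IsProfile d g (1 / 4))
    (hd : 2 ≤ d) {k n m : ℕ} (hk : (1 / 2 : ℝ) ^ k ≤ 1 - ρ) (hn : k ≤ n)
    (hm : k ≤ m) {z w : Euc d} (hz : ‖z‖ ≤ ρ) (hw : ‖w‖ ≤ ρ) (hzw : (1 / 2) ^ k < dist z w) :
    inner ℝ (X.average g n z) (X.average g m w) = X.k2 z w := by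
  have h0 : (0 : ℝ) < (1 / 2) ^ k := by positivity
  have hlt := lt_k2eps h0 hk hz hw hzw
  have hle : ∀ {j}, k ≤ j → (1 / 2 : ℝ) ^ j * (1 / 4) < k2eps z w := fun hj => by
    have := pow_le_pow_of_le_one (by norm_num : (0 : ℝ) ≤ 1 / 2) (by norm_num) hj
    linarith
  exact X.inner_toL2_radial_eq_k2 (one_le_two.trans hd) (dist_pos.1 (h0.trans hzw))
    (isProfile_dilate_half hg n) (isProfile_dilate_half hg m) (hle hn) (hle hm)

lemma half_pow_add_lt_one {n : ℕ} (hn : (1 / 2 : ℝ) ^ n ≤ 1 - ρ) :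
    ρ + (1 / 2) ^ n * (1 / 4) < 1 := by
  have h0 : (0 : ℝ) < (1 / 2) ^ n := by positivity
  linarith

lemma integrable_mul_inner_average (hg : IsProfile d g (1 / 4)) (hf : IsTestFun f)
    (hfρ : tsupport f ⊆ closedBall 0 ρ) {n : ℕ} (hn : (1 / 2 : ℝ) ^ n ≤ 1 - ρ)
    (hh : IsTestFun h) (hhB : tsupport h ⊆ ball (0 : Euc d) 1) :
    Integrable fun z => f z * inner ℝ (X.average g n z) (X.toL2 h) :=
  (X.continuous_mul_inner_radial (isProfile_dilate_half hg n) hf hfρ (half_pow_add_lt_one hn) hh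
    hhB).integrable_of_hasCompactSupport hf.2.mul_right

lemma integral_mul_inner_average_sub (hg : IsProfile d g (1 / 4)) (hf : IsTestFun f)
    (hfρ : tsupport f ⊆ closedBall 0 ρ) {n : ℕ} (hn : (1 / 2 : ℝ) ^ n ≤ 1 - ρ)
    (hh : IsTestFun h) (hhB : tsupport h ⊆ ball (0 : Euc d) 1) :
    ∫ z, f z * inner ℝ (X.average g n z - X.average g (n + 1) z) (X.toL2 h)
      = inner ℝ (X.toL2 (mollify (dilateProfile d g ((1 / 2) ^ n)) f)
        - X.toL2 (mollify (dilateProfile d g ((1 / 2) ^ (n + 1))) f)) (X.toL2 h) := by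
  have hn' : (1 / 2 : ℝ) ^ (n + 1) ≤ 1 - ρ :=
    (pow_le_pow_of_le_one (by norm_num) (by norm_num) n.le_succ).trans hn
  have hi := X.integral_mul_inner_radial (isProfile_dilate_half hg n) hf hfρ
    (half_pow_add_lt_one hn) hh hhB
  have hi' := X.integral_mul_inner_radial (isProfile_dilate_half hg (n + 1)) hf hfρ
    (half_pow_add_lt_one hn') hh hhB
  simp_rw [inner_sub_left, mul_sub]
  rw [integral_sub (X.integrable_mul_inner_average hg hf hfρ hn hh hhB)
    (X.integrable_mul_inner_average hg hf hfρ hn' hh hhB), ← hi, ← hi']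
  rfl

lemma exists_norm_average_sub_le (hg : IsProfile d g (1 / 4))
    (hd : 2 ≤ d) : ∃ C : ℝ, 0 ≤ C ∧ ∀ (n : ℕ) (z : Euc d), ‖z‖ < 1 →
    ((1 / 2 : ℝ) ^ n) ^ d * ‖X.average g n z - X.average g (n + 1) z‖ ^ 2 ≤ C * (1 / 2) ^ n := by
  obtain ⟨C, hC, h⟩ := X.exists_norm_toL2_radial_le hd hg
  refine ⟨2 * (C + 2 ^ d * C), by positivity, fun n z hz => ?_⟩
  have h1 := h n z hz
  have h2 := h (n + 1) z hz
  rw [pow_succ (1 / 2 : ℝ) n, mul_pow, ← pow_succ] at h2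
  have h3 : ‖X.average g n z - X.average g (n + 1) z‖ ^ 2
      ≤ 2 * (‖X.average g n z‖ ^ 2 + ‖X.average g (n + 1) z‖ ^ 2) := by
    have := norm_sub_le (X.average g n z) (X.average g (n + 1) z)
    nlinarith [norm_nonneg (X.average g n z - X.average g (n + 1) z),
      two_mul_le_add_sq ‖X.average g n z‖ ‖X.average g (n + 1) z‖]
  have h4 : (2 : ℝ) ^ d * (1 / 2) ^ d = 1 := by rw [← mul_pow]; norm_num
  have h5 : ((1 / 2 : ℝ) ^ n) ^ d * ‖X.average g (n + 1) z‖ ^ 2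
      ≤ 2 ^ d * C * (1 / 2) ^ n := by
    calc ((1 / 2 : ℝ) ^ n) ^ d * ‖X.average g (n + 1) z‖ ^ 2
        = 2 ^ d * (((1 / 2 : ℝ) ^ n) ^ d * (1 / 2) ^ d * ‖X.average g (n + 1) z‖ ^ 2) := by
          rw [← mul_assoc, mul_left_comm, h4, mul_one]
      _ ≤ 2 ^ d * (C * ((1 / 2) ^ n * (1 / 2))) := by
          refine mul_le_mul_of_nonneg_left ?_ (by positivity)
          rw [← pow_succ]
          exact h2
      _ ≤ 2 ^ d * C * (1 / 2) ^ n := by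
          have : 0 ≤ 2 ^ d * C * (1 / 2) ^ n := by positivity
          nlinarith
  have h6 := mul_le_mul_of_nonneg_left h3 (by positivity : 0 ≤ ((1 / 2 : ℝ) ^ n) ^ d)
  have h7 : ((1 / 2 : ℝ) ^ n) ^ d * ‖X.average g n z‖ ^ 2 ≤ C * (1 / 2) ^ n := h1
  nlinarith

lemma exists_norm_toL2_mollify_sub_le (hg : IsProfile d g (1 / 4)) (hf : IsTestFun f)
    (hfρ : tsupport f ⊆ closedBall 0 ρ) (hd : 2 ≤ d) (hρ : 0 ≤ ρ) : ∃ C : ℝ, 0 ≤ C ∧ ∀ n : ℕ,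
    (1 / 2 : ℝ) ^ n ≤ 1 - ρ →
    ‖X.toL2 (mollify (dilateProfile d g ((1 / 2) ^ n)) f)
      - X.toL2 (mollify (dilateProfile d g ((1 / 2) ^ (n + 1))) f)‖ ^ 2 ≤ C * (1 / 2) ^ n := by
  obtain ⟨C, hC, hbd⟩ := X.exists_norm_average_sub_le hg hd
  obtain ⟨A, hA, hfA⟩ := hf.exists_abs_le
  set V := volume.real (ball (0 : Euc d) 1) with hV
  refine ⟨A * (A * C * V) * (ρ ^ d * V), by positivity, fun n hn => ?_⟩
  have h0 : (0 : ℝ) < (1 / 2) ^ n := by positivity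
  have hf0 : ∀ z ∉ closedBall (0 : Euc d) ρ, f z = 0 := fun z hz =>
    image_eq_zero_of_notMem_tsupport fun h => hz (hfρ h)
  have ht := isTestFun_mollify (isProfile_dilate_half hg n) hf hfρ
  have ht' := isTestFun_mollify (isProfile_dilate_half hg (n + 1)) hf hfρ
  have hn' : (1 / 2 : ℝ) ^ (n + 1) ≤ 1 - ρ :=
    (pow_le_pow_of_le_one (by norm_num) (by norm_num) n.le_succ).trans hn
  set Δ : Euc d → Lp ℝ 2 X.P := fun z => X.average g n z - X.average g (n + 1) z with hΔ
  have hsub : ∀ {a b : Euc d → ℝ}, tsupport a ⊆ ball 0 1 → tsupport b ⊆ ball 0 1 →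
      tsupport (a - b) ⊆ ball (0 : Euc d) 1 := fun ha hb =>
    (tsupport_sub _ _).trans (union_subset ha hb)
  rw [← real_inner_self_eq_norm_sq]
  nth_rewrite 2 [← X.toL2_sub ht ht']
  rw [← X.integral_mul_inner_average_sub hg hf hfρ hn (ht.sub ht')
    (hsub ((tsupport_mollify_subset (isProfile_dilate_half hg n) hfρ).trans
        (closedBall_subset_ball (half_pow_add_lt_one hn)))
      ((tsupport_mollify_subset (isProfile_dilate_half hg (n + 1)) hfρ).trans
        (closedBall_subset_ball (half_pow_add_lt_one hn'))))]
  have hinner : ∀ z, ‖z‖ ≤ ρ → |inner ℝ (Δ z) (X.toL2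
      (mollify (dilateProfile d g ((1 / 2) ^ n)) f
        - mollify (dilateProfile d g ((1 / 2) ^ (n + 1))) f))| ≤ A * C * V * (1 / 2) ^ n := by
    intro z hz
    have hz1 : ‖z‖ < 1 := by linarith
    have hΔz : Δ z = X.toL2 (radial (dilateProfile d g ((1 / 2) ^ n)) z
        - radial (dilateProfile d g ((1 / 2) ^ (n + 1))) z) :=
      (X.toL2_sub (isTestFun_average hg n z) (isTestFun_average hg (n + 1) z)).symm
    have hsq : ∀ w, ‖w‖ < 1 → ‖Δ w‖ ^ 2 ≤ C * (1 / 2) ^ n / ((1 / 2 : ℝ) ^ n) ^ d := fun w hw => by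
      rw [le_div_iff₀ (by positivity), mul_comm]
      exact hbd n w hw
    rw [real_inner_comm, X.toL2_sub ht ht', hΔz, ← X.integral_mul_inner_average_sub hg hf hfρ hn
      ((isTestFun_average hg n z).sub (isTestFun_average hg (n + 1) z))
      (hsub (tsupport_average_subset hg hn hz) (tsupport_average_subset hg hn' hz)), ← hΔz]
    refine (abs_integral_le_of_closedBall (M := A * (C * (1 / 2) ^ n / ((1 / 2 : ℝ) ^ n) ^ d))
      (z := z) h0.le (fun w => ?_) (fun w hw => ?_)).trans_eq ?_
    · rw [abs_mul]
      by_cases hwρ : w ∈ closedBall (0 : Euc d) ρ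
      · have hw1 : ‖w‖ < 1 := (mem_closedBall_zero_iff.1 hwρ).trans_lt (by linarith)
        exact mul_le_mul (hfA w) (abs_real_inner_le_of_norm_sq_le (hsq w hw1) (hsq z hz1))
          (abs_nonneg _) hA
      · rw [hf0 w hwρ, abs_zero, zero_mul]
        positivity
    · by_cases hwρ : w ∈ closedBall (0 : Euc d) ρ
      · have hwρ' := mem_closedBall_zero_iff.1 hwρ
        have hd' : (1 / 2 : ℝ) ^ n < dist w z := not_le.1 hw
        have hk := fun {i j : ℕ} (hi : n ≤ i) (hj : n ≤ j) =>
          X.inner_average hg hd hn hi hj hwρ' hz hd'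
        simp only [hΔ, inner_sub_left, inner_sub_right, hk le_rfl le_rfl,
          hk le_rfl n.le_succ, hk n.le_succ le_rfl, hk n.le_succ n.le_succ]
        ring
      · rw [hf0 w hwρ, zero_mul]
    · field_simp
      rfl
  refine (le_abs_self _).trans ((abs_integral_le_of_closedBall
    (M := A * (A * C * V * (1 / 2) ^ n)) (z := 0) hρ (fun z => ?_) (fun z hz => ?_)).trans_eq ?_)
  · rw [abs_mul]
    by_cases hz : z ∈ closedBall (0 : Euc d) ρ
    · exact mul_le_mul (hfA z) (hinner z (mem_closedBall_zero_iff.1 hz)) (abs_nonneg _) hA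
    · rw [hf0 z hz, abs_zero, zero_mul]
      positivity
  · rw [hf0 z hz, zero_mul]
  · ring

lemma exists_tendsto_toL2_mollify (hg : IsProfile d g (1 / 4)) (hf : IsTestFun f)
    (hd : 2 ≤ d) (hg0 : ∀ t, 0 ≤ g t) (hρ : 0 ≤ ρ) (hρ1 : ρ < 1)
    (hfρ : tsupport f ⊆ closedBall 0 ρ) : ∃ L : Lp ℝ 2 X.P,
      Tendsto (fun n : ℕ => X.toL2 (mollify (dilateProfile d g ((1 / 2) ^ n)) f)) atTop (𝓝 L) ∧
      ∀ h : Euc d → ℝ, IsTestFun h → tsupport h ⊆ ball (0 : Euc d) 1 →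
        inner ℝ L (X.toL2 h) = inner ℝ (X.toL2 f) (X.toL2 h) := by
  obtain ⟨C, hC, hle⟩ := X.exists_norm_toL2_mollify_sub_le hg hf hfρ hd hρ
  obtain ⟨N, hN⟩ := exists_pow_lt_of_lt_one (sub_pos.2 hρ1) (by norm_num : (1 / 2 : ℝ) < 1)
  have hN' : ∀ n, (1 / 2 : ℝ) ^ (n + N) ≤ 1 - ρ := fun n =>
    (pow_le_pow_of_le_one (by norm_num) (by norm_num) (Nat.le_add_left N n)).trans hN.le
  have hcauchy : CauchySeq fun n : ℕ =>
      X.toL2 (mollify (dilateProfile d g ((1 / 2) ^ (n + N))) f) := by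
    refine cauchySeq_of_le_geometric (√(1 / 2)) (√C) ?_ fun n => ?_
    · rw [Real.sqrt_lt' one_pos]
      norm_num
    · rw [dist_eq_norm]
      refine abs_le_of_sq_le_sq' ?_ (by positivity) |>.2
      rw [mul_pow, Real.sq_sqrt hC, ← pow_mul, mul_comm n 2, pow_mul, Real.sq_sqrt (by norm_num),
        Nat.add_right_comm]
      refine (hle (n + N) (hN' n)).trans (mul_le_mul_of_nonneg_left ?_ hC)
      exact pow_le_pow_of_le_one (by norm_num) (by norm_num) (Nat.le_add_right n N)
  obtain ⟨L, hL⟩ := cauchySeq_tendsto_of_complete hcauchy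
  refine ⟨L, (tendsto_add_atTop_iff_nat N).1 hL, fun h hh hhB => ?_⟩
  have hlim := X.tendsto_inner_toL2
    (f := fun n => mollify (dilateProfile d g ((1 / 2) ^ (n + N))) f)
    (K := closedBall (0 : Euc d) (ρ + (1 / 2) ^ N * (1 / 4)))
    (isCompact_closedBall _ _) (closedBall_subset_ball (half_pow_add_lt_one hN.le))
    (fun n => isTestFun_mollify (isProfile_dilate_half hg (n + N)) hf hfρ) hf hh hhB
    (fun n => (tsupport_mollify_subset (isProfile_dilate_half hg (n + N)) hfρ).trans
      (closedBall_subset_closedBall (by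
        have := pow_le_pow_of_le_one (by norm_num : (0 : ℝ) ≤ 1 / 2) (by norm_num)
          (Nat.le_add_left N n)
        linarith)))
    (hfρ.trans (closedBall_subset_closedBall (by
      have : (0 : ℝ) < (1 / 2) ^ N := by positivity
      linarith)))
    (tendstoUniformly_iteratedFDeriv_mollify (fun n => isProfile_dilate_half hg (n + N))
      (fun n t => mul_nonneg (by positivity) (hg0 _)) (by
        have h1 := ((tendsto_add_atTop_iff_nat N).2
          (tendsto_pow_atTop_nhds_zero_of_lt_one (r := (1 / 2 : ℝ)) (by norm_num)
            (by norm_num))).mul_const (1 / 4 : ℝ)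
        rwa [zero_mul] at h1) hf)
  exact tendsto_nhds_unique (hL.inner (𝕜 := ℝ) tendsto_const_nhds) hlim

end GFF

namespace GFF

variable {d : ℕ} {Ω : Type} [MeasurableSpace Ω] (X : GFF d Ω) {g : ℝ → ℝ} {ρ : ℝ}
    {f₁ f₂ : Euc d → ℝ}

lemma tendsto_inner_toL2_mollify (hg : IsProfile d g (1 / 4)) (h₁ : IsTestFun f₁)
    (h₂ : IsTestFun f₂) (hd : 2 ≤ d) (hg0 : ∀ t, 0 ≤ g t) (hρ : 0 ≤ ρ) (hρ1 : ρ < 1)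
    (hf₁ : tsupport f₁ ⊆ closedBall 0 ρ) (hf₂ : tsupport f₂ ⊆ closedBall 0 ρ) :
    Tendsto (fun n : ℕ => inner ℝ (X.toL2 (mollify (dilateProfile d g ((1 / 2) ^ n)) f₁))
        (X.toL2 (mollify (dilateProfile d g ((1 / 2) ^ n)) f₂))) atTop
      (𝓝 (inner ℝ (X.toL2 f₁) (X.toL2 f₂))) := by
  obtain ⟨L₁, hL₁, hi₁⟩ := X.exists_tendsto_toL2_mollify hg h₁ hd hg0 hρ hρ1 hf₁
  obtain ⟨L₂, hL₂, hi₂⟩ := X.exists_tendsto_toL2_mollify hg h₂ hd hg0 hρ hρ1 hf₂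
  have hev : ∀ᶠ n : ℕ in atTop, (1 / 2 : ℝ) ^ n < 1 - ρ :=
    (tendsto_pow_atTop_nhds_zero_of_lt_one (by norm_num) (by norm_num)).eventually_lt_const
      (sub_pos.2 hρ1)
  have heq : inner ℝ L₁ L₂ = inner ℝ (X.toL2 f₁) L₂ := by
    refine tendsto_nhds_unique_of_eventuallyEq (tendsto_const_nhds.inner (𝕜 := ℝ) hL₂)
      (tendsto_const_nhds.inner (𝕜 := ℝ) hL₂) ?_
    filter_upwards [hev] with n hn
    exact hi₁ _ (isTestFun_mollify (isProfile_dilate_half hg n) h₂ hf₂)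
      ((tsupport_mollify_subset (isProfile_dilate_half hg n) hf₂).trans
        (closedBall_subset_ball (half_pow_add_lt_one hn.le)))
  have h := hL₁.inner (𝕜 := ℝ) hL₂
  rwa [heq, real_inner_comm, hi₂ f₁ h₁ (hf₁.trans (closedBall_subset_ball hρ1)),
    real_inner_comm] at h

lemma measurable_mul_mul_inner_average (hg : IsProfile d g (1 / 4)) (h₁ : IsTestFun f₁)
    (h₂ : IsTestFun f₂) (hf₁ : tsupport f₁ ⊆ closedBall 0 ρ) (hf₂ : tsupport f₂ ⊆ closedBall 0 ρ)
    {n : ℕ} (hn : (1 / 2 : ℝ) ^ n ≤ 1 - ρ) :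
    Measurable fun p : Euc d × Euc d =>
      f₁ p.1 * f₂ p.2 * inner ℝ (X.average g n p.1) (X.average g n p.2) := by
  have hcont : ∀ {u v : Euc d → ℝ}, IsTestFun u → tsupport u ⊆ closedBall 0 ρ →
      tsupport v ⊆ closedBall 0 ρ → ∀ w, Continuous fun z =>
        u z * v w * inner ℝ (X.average g n z) (X.average g n w) := by
    intro u v hu huρ hvρ w
    by_cases hw : w ∈ closedBall (0 : Euc d) ρ
    · have h := (X.continuous_mul_inner_radial (isProfile_dilate_half hg n) hu huρ
        (half_pow_add_lt_one hn) (isTestFun_average hg n w)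
        (tsupport_average_subset hg hn (mem_closedBall_zero_iff.1 hw))).const_mul (v w)
      exact h.congr fun z => by simp only [average]; ring
    · simp only [image_eq_zero_of_notMem_tsupport fun h => hw (hvρ h), mul_zero, zero_mul]
      exact continuous_const
  refine (stronglyMeasurable_uncurry_of_continuous_of_stronglyMeasurable
    (u := fun z w => f₁ z * f₂ w * inner ℝ (X.average g n z) (X.average g n w))
    (fun w => ?_) fun z => ?_).measurable
  · exact hcont h₁ hf₁ hf₂ w
  · refine ((hcont h₂ hf₂ hf₁ z).congr fun w => ?_).stronglyMeasurable
    rw [real_inner_comm, mul_comm (f₂ w)]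

lemma exists_abs_mul_mul_inner_average_le (hg : IsProfile d g (1 / 4)) (h₁ : IsTestFun f₁)
    (h₂ : IsTestFun f₂) (hf₁ : tsupport f₁ ⊆ closedBall 0 ρ) (hf₂ : tsupport f₂ ⊆ closedBall 0 ρ)
    (hd : 2 ≤ d) (hρ1 : ρ < 1) : ∃ C : ℝ, 0 ≤ C ∧
    ∀ (n : ℕ) (z w : Euc d), |f₁ z * f₂ w * inner ℝ (X.average g n z) (X.average g n w)|
      ≤ C * (1 / 2) ^ n / ((1 / 2) ^ n) ^ d := by
  obtain ⟨C, hC, hbd⟩ := X.exists_norm_toL2_radial_le hd hg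
  obtain ⟨A₁, hA₁, hfA₁⟩ := h₁.exists_abs_le
  obtain ⟨A₂, hA₂, hfA₂⟩ := h₂.exists_abs_le
  refine ⟨A₁ * A₂ * C, by positivity, fun n z w => ?_⟩
  have hsq : ∀ w, ‖w‖ < 1 → ‖X.average g n w‖ ^ 2 ≤ C * (1 / 2) ^ n / ((1 / 2 : ℝ) ^ n) ^ d :=
    fun w hw => by
      rw [le_div_iff₀ (by positivity), mul_comm]
      exact hbd n w hw
  have h0 : 0 ≤ A₁ * A₂ * C * (1 / 2) ^ n / ((1 / 2 : ℝ) ^ n) ^ d := by positivity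
  by_cases hz : z ∈ closedBall (0 : Euc d) ρ
  · by_cases hw : w ∈ closedBall (0 : Euc d) ρ
    · have hz1 := (mem_closedBall_zero_iff.1 hz).trans_lt hρ1
      have hw1 := (mem_closedBall_zero_iff.1 hw).trans_lt hρ1
      rw [abs_mul, abs_mul, mul_assoc _ C, mul_div_assoc]
      exact mul_le_mul (mul_le_mul (hfA₁ z) (hfA₂ w) (abs_nonneg _) hA₁)
        (abs_real_inner_le_of_norm_sq_le (hsq z hz1) (hsq w hw1)) (abs_nonneg _) (by positivity)
    · simpa [image_eq_zero_of_notMem_tsupport fun h => hw (hf₂ h)] using h0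
  · simpa [image_eq_zero_of_notMem_tsupport fun h => hz (hf₁ h)] using h0

lemma integrable_mul_mul_inner_average (hg : IsProfile d g (1 / 4)) (h₁ : IsTestFun f₁)
    (h₂ : IsTestFun f₂) (hf₁ : tsupport f₁ ⊆ closedBall 0 ρ) (hf₂ : tsupport f₂ ⊆ closedBall 0 ρ)
    (hd : 2 ≤ d) (hρ1 : ρ < 1) {n : ℕ}
    (hn : (1 / 2 : ℝ) ^ n ≤ 1 - ρ) :
    Integrable fun p : Euc d × Euc d =>
      f₁ p.1 * f₂ p.2 * inner ℝ (X.average g n p.1) (X.average g n p.2) := by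
  obtain ⟨C, -, hbd⟩ := X.exists_abs_mul_mul_inner_average_le hg h₁ h₂ hf₁ hf₂ hd hρ1
  have hsupp : Function.support (fun p : Euc d × Euc d =>
      f₁ p.1 * f₂ p.2 * inner ℝ (X.average g n p.1) (X.average g n p.2))
      ⊆ closedBall (0 : Euc d) ρ ×ˢ closedBall (0 : Euc d) ρ := fun p hp =>
    ⟨hf₁ (subset_tsupport f₁ (left_ne_zero_of_mul (left_ne_zero_of_mul hp))),
      hf₂ (subset_tsupport f₂ (right_ne_zero_of_mul (left_ne_zero_of_mul hp)))⟩
  rw [← integrableOn_iff_integrable_of_support_subset hsupp]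
  exact Measure.integrableOn_of_bounded
    ((isCompact_closedBall _ _).prod (isCompact_closedBall _ _)).measure_lt_top.ne
    (X.measurable_mul_mul_inner_average hg h₁ h₂ hf₁ hf₂ hn).aestronglyMeasurable
    (Eventually.of_forall fun p => hbd n p.1 p.2)

lemma integral_mul_mul_inner_average (hg : IsProfile d g (1 / 4)) (h₁ : IsTestFun f₁)
    (h₂ : IsTestFun f₂) (hf₁ : tsupport f₁ ⊆ closedBall 0 ρ) (hf₂ : tsupport f₂ ⊆ closedBall 0 ρ)
    (hd : 2 ≤ d) (hρ1 : ρ < 1) {n : ℕ}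
    (hn : (1 / 2 : ℝ) ^ n ≤ 1 - ρ) :
    ∫ p : Euc d × Euc d, f₁ p.1 * f₂ p.2 * inner ℝ (X.average g n p.1) (X.average g n p.2)
      = inner ℝ (X.toL2 (mollify (dilateProfile d g ((1 / 2) ^ n)) f₁))
        (X.toL2 (mollify (dilateProfile d g ((1 / 2) ^ n)) f₂)) := by
  have hp := isProfile_dilate_half hg n
  rw [Measure.volume_eq_prod, integral_prod _
    (X.integrable_mul_mul_inner_average hg h₁ h₂ hf₁ hf₂ hd hρ1 hn),
    ← X.integral_mul_inner_radial hp h₁ hf₁ (half_pow_add_lt_one hn)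
      (isTestFun_mollify hp h₂ hf₂)
      ((tsupport_mollify_subset hp hf₂).trans (closedBall_subset_ball (half_pow_add_lt_one hn)))]
  refine integral_congr_ae (Eventually.of_forall fun z => ?_)
  by_cases hz : z ∈ closedBall (0 : Euc d) ρ
  · simp only
    rw [real_inner_comm, ← X.integral_mul_inner_radial hp h₂ hf₂ (half_pow_add_lt_one hn)
      (isTestFun_average hg n z) (tsupport_average_subset hg hn (mem_closedBall_zero_iff.1 hz)),
      ← integral_const_mul]
    refine integral_congr_ae (Eventually.of_forall fun w => ?_)
    simp only [average, mul_assoc]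
    rw [real_inner_comm]
  · simp [image_eq_zero_of_notMem_tsupport fun h => hz (hf₁ h)]

lemma setIntegral_mul_mul_k2_eq (hg : IsProfile d g (1 / 4)) (hf₁ : tsupport f₁ ⊆ closedBall 0 ρ)
    (hf₂ : tsupport f₂ ⊆ closedBall 0 ρ) (hd : 2 ≤ d) (hρ1 : ρ < 1) {n : ℕ}
    (hn : (1 / 2 : ℝ) ^ n ≤ 1 - ρ) {a : ℝ} (ha : (1 / 2) ^ n ≤ a) :
    ∫ p in (ball (0 : Euc d) 1 ×ˢ ball (0 : Euc d) 1) ∩ {p : Euc d × Euc d | a < dist p.1 p.2},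
        f₁ p.1 * f₂ p.2 * X.k2 p.1 p.2
      = ∫ p in {p : Euc d × Euc d | a < dist p.1 p.2},
        f₁ p.1 * f₂ p.2 * inner ℝ (X.average g n p.1) (X.average g n p.2) := by
  have hm : MeasurableSet {p : Euc d × Euc d | a < dist p.1 p.2} :=
    (isOpen_lt continuous_const continuous_dist).measurableSet
  have hB : ∀ {f : Euc d → ℝ}, tsupport f ⊆ closedBall 0 ρ → ∀ z ∉ ball (0 : Euc d) 1, f z = 0 :=
    fun hf z hz => image_eq_zero_of_notMem_tsupport fun h =>
      hz (closedBall_subset_ball hρ1 (hf h))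
  refine (setIntegral_eq_of_subset_of_forall_sdiff_eq_zero hm inter_subset_right ?_).symm.trans
    (setIntegral_congr_fun hm fun p hp => ?_)
  rotate_left
  · by_cases hz : p.1 ∈ closedBall (0 : Euc d) ρ
    · by_cases hw : p.2 ∈ closedBall (0 : Euc d) ρ
      · rw [X.inner_average hg hd hn le_rfl le_rfl (mem_closedBall_zero_iff.1 hz)
          (mem_closedBall_zero_iff.1 hw) (ha.trans_lt hp)]
      · simp [image_eq_zero_of_notMem_tsupport fun h => hw (hf₂ h)]
    · simp [image_eq_zero_of_notMem_tsupport fun h => hz (hf₁ h)]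
  · rintro p ⟨hp, hpB⟩
    by_cases hz : p.1 ∈ ball (0 : Euc d) 1
    · by_cases hw : p.2 ∈ ball (0 : Euc d) 1
      · exact absurd ⟨⟨hz, hw⟩, hp⟩ hpB
      · simp [hB hf₂ _ hw]
    · simp [hB hf₁ _ hz]

lemma exists_abs_setIntegral_sub_le (hg : IsProfile d g (1 / 4)) (h₁ : IsTestFun f₁)
    (h₂ : IsTestFun f₂) (hf₁ : tsupport f₁ ⊆ closedBall 0 ρ) (hf₂ : tsupport f₂ ⊆ closedBall 0 ρ)
    (hd : 2 ≤ d) (hρ : 0 ≤ ρ) (hρ1 : ρ < 1) : ∃ C : ℝ, 0 ≤ C ∧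
    ∀ (n : ℕ) (a : ℝ), (1 / 2 : ℝ) ^ n ≤ 1 - ρ → (1 / 2) ^ n ≤ a → a ≤ 2 * (1 / 2) ^ n →
    |(∫ p in (ball (0 : Euc d) 1 ×ˢ ball (0 : Euc d) 1) ∩
        {p : Euc d × Euc d | a < dist p.1 p.2}, f₁ p.1 * f₂ p.2 * X.k2 p.1 p.2)
      - inner ℝ (X.toL2 (mollify (dilateProfile d g ((1 / 2) ^ n)) f₁))
        (X.toL2 (mollify (dilateProfile d g ((1 / 2) ^ n)) f₂))| ≤ C * (1 / 2) ^ n := by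
  obtain ⟨C, hC, hbd⟩ := X.exists_abs_mul_mul_inner_average_le hg h₁ h₂ hf₁ hf₂ hd hρ1
  set V := volume.real (ball (0 : Euc d) 1) with hV
  refine ⟨C * 2 ^ d * V * (ρ ^ d * V), by positivity, fun n a hn ha ha2 => ?_⟩
  have h0 : (0 : ℝ) < (1 / 2) ^ n := by positivity
  have ha0 : 0 ≤ a := h0.le.trans ha
  set B : Euc d × Euc d → ℝ := fun p =>
    f₁ p.1 * f₂ p.2 * inner ℝ (X.average g n p.1) (X.average g n p.2) with hBdef
  set S : Set (Euc d × Euc d) := {p | a < dist p.1 p.2} with hS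
  have hm : MeasurableSet S := (isOpen_lt continuous_const continuous_dist).measurableSet
  have hint : Integrable B := X.integrable_mul_mul_inner_average hg h₁ h₂ hf₁ hf₂ hd hρ1 hn
  rw [X.setIntegral_mul_mul_k2_eq hg hf₁ hf₂ hd hρ1 hn ha,
    ← X.integral_mul_mul_inner_average hg h₁ h₂ hf₁ hf₂ hd hρ1 hn,
    ← integral_add_compl hm hint, sub_add_cancel_left, abs_neg, ← integral_indicator hm.compl,
    Measure.volume_eq_prod, integral_prod _ (hint.indicator hm.compl)]
  have hle : ∀ p, |Sᶜ.indicator B p| ≤ C * (1 / 2) ^ n / ((1 / 2) ^ n) ^ d := fun p =>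
    (norm_indicator_le_norm_self B p).trans (hbd n p.1 p.2)
  have hM : 0 ≤ C * (1 / 2) ^ n / ((1 / 2 : ℝ) ^ n) ^ d := by positivity
  have hinner : ∀ z, |∫ w, Sᶜ.indicator B (z, w)| ≤ C * 2 ^ d * V * (1 / 2) ^ n := fun z => by
    calc |∫ w, Sᶜ.indicator B (z, w)|
        ≤ C * (1 / 2) ^ n / ((1 / 2) ^ n) ^ d * (a ^ d * V) :=
          abs_integral_le_of_closedBall (z := z) ha0 (fun w => hle (z, w)) fun w hw =>
            indicator_of_notMem (by simpa [hS, dist_comm] using hw) B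
      _ ≤ C * (1 / 2) ^ n / ((1 / 2) ^ n) ^ d * ((2 * (1 / 2) ^ n) ^ d * V) := by gcongr
      _ = C * 2 ^ d * V * (1 / 2) ^ n := by
          rw [mul_pow]
          field_simp
  refine (abs_integral_le_of_closedBall (z := 0) hρ hinner fun z hz => ?_).trans_eq (by ring)
  refine integral_eq_zero_of_ae (Eventually.of_forall fun w => ?_)
  refine indicator_apply_eq_zero.2 fun _ => ?_
  simp [hBdef, image_eq_zero_of_notMem_tsupport fun h => hz (hf₁ h)]

end GFF

lemma exists_tsupport_subset_closedBall {d : ℕ} {f₁ f₂ : Euc d → ℝ}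
    (hs₁ : tsupport f₁ ⊆ ball (0 : Euc d) 1) (hs₂ : tsupport f₂ ⊆ ball (0 : Euc d) 1) :
    ∃ ρ : ℝ, 0 ≤ ρ ∧ ρ < 1 ∧ tsupport f₁ ⊆ closedBall 0 ρ ∧ tsupport f₂ ⊆ closedBall 0 ρ := by
  obtain ⟨ρ, hρ, hsub⟩ := exists_pos_lt_subset_ball one_pos
    ((isClosed_tsupport f₁).union (isClosed_tsupport f₂)) (union_subset hs₁ hs₂)
  have h := (union_subset_iff.1 (hsub.trans ball_subset_closedBall))
  exact ⟨ρ, hρ.1.le, hρ.2, h.1, h.2⟩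

/-- the diagonal contribution of the two-point function is negligible:
`K₂(f₁,f₂)` equals the off-diagonal limit of `∬ f₁ k₂ f₂`. -/
theorem statement5 (d : ℕ) (hd : 2 ≤ d) (Ω : Type) [MeasurableSpace Ω] (X : GFF d Ω) (f₁ f₂ : Euc d → ℝ)
    (h₁ : IsTestFun f₁) (h₂ : IsTestFun f₂)
    (hs₁ : tsupport f₁ ⊆ ball (0 : Euc d) 1) (hs₂ : tsupport f₂ ⊆ ball (0 : Euc d) 1) :
    Tendsto
      (fun a : ℝ => ∫ p in (ball (0 : Euc d) 1 ×ˢ ball (0 : Euc d) 1) ∩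
          {p : Euc d × Euc d | a < dist p.1 p.2},
        f₁ p.1 * f₂ p.2 * X.k2 p.1 p.2)
      (𝓝[>] (0 : ℝ))
      (𝓝 (∫ ω, X.h 0 1 f₁ ω * X.h 0 1 f₂ ω ∂X.P)) := by
  obtain ⟨g, hg, hg0, -⟩ := exists_isProfile (one_le_two.trans hd)
    (by norm_num : (0 : ℝ) < 1 / 8) (by norm_num : (1 / 8 : ℝ) < 1 / 4)
  obtain ⟨ρ, hρ, hρ1, hf₁, hf₂⟩ := exists_tsupport_subset_closedBall hs₁ hs₂
  obtain ⟨C, hC, hle⟩ := X.exists_abs_setIntegral_sub_le hg h₁ h₂ hf₁ hf₂ hd hρ hρ1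
  have hlim := X.tendsto_inner_toL2_mollify hg h₁ h₂ hd hg0 hρ hρ1 hf₁ hf₂
  rw [X.inner_toL2 h₁ h₂] at hlim
  have hpow : Tendsto (fun n : ℕ => (1 / 2 : ℝ) ^ n) atTop (𝓝 0) :=
    tendsto_pow_atTop_nhds_zero_of_lt_one (by norm_num) (by norm_num)
  have hCpow : Tendsto (fun n : ℕ => C * (1 / 2 : ℝ) ^ n) atTop (𝓝 0) := by
    simpa using hpow.const_mul C
  rw [Metric.tendsto_nhds]
  intro ε hε
  obtain ⟨N, hN⟩ := eventually_atTop.1 (((Metric.tendsto_nhds.1 hlim (ε / 2) (half_pos hε)).and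
    (hpow.eventually_lt_const (sub_pos.2 hρ1))).and
    (hCpow.eventually_lt_const (half_pos hε)))
  filter_upwards [Ioo_mem_nhdsGT (by positivity : (0 : ℝ) < (1 / 2) ^ N)] with a ha
  obtain ⟨n, hn, hn'⟩ := exists_nat_pow_near_of_lt_one ha.1
    (ha.2.le.trans (pow_le_one₀ (by norm_num) (by norm_num))) (by norm_num : (0 : ℝ) < 1 / 2)
    (by norm_num : (1 / 2 : ℝ) < 1)
  have hNn : N ≤ n + 1 :=
    ((pow_lt_pow_iff_right_of_lt_one₀ (by norm_num) (by norm_num)).1 (hn.trans ha.2)).le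
  obtain ⟨⟨hd1, hd2⟩, hd3⟩ := hN (n + 1) hNn
  have hd4 := hle (n + 1) a hd2.le hn.le (by rw [pow_succ]; linarith)
  rw [← Real.dist_eq] at hd4
  exact (dist_triangle _ _ _).trans_lt (by linarith)
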